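/- arXiv:math/0305136 — 2 statements merged into one kernel-verified Lean document; each statement's English description precedes it below -/
import Mathlib

section
/- Let ι be a D2 Frobenius 1-morphism in an additive bicategory with D2 quasi-basis ∑ᵢ yᵢ⊗xᵢ. Then A = C²(ι×ῑ,ι×ῑ) carries a left bialgebroid structure over L = C²(ι,ι) with source s_L(l) = l×ῑ, target t_L(l) = ι×μ(l), coproduct γ_L(a) = ∑ᵢ S_A⁻¹(yᵢ) ⊗ (xᵢ ∗ a) = ∑ᵢ (a ∗ S_A⁻¹(yᵢ)) ⊗ xᵢ, and counit π_L(a) = φ_L(a∘i_A). -/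
open CategoryTheory Bicategory

universe w v u

variable {C : Type u} [Bicategory.{w, v} C] {a b : C}

/-- Duality data exhibiting `κ` as a two-sided dual of `ι`: `(evL, coevL)` exhibit a
left-dual pair and `(evR, coevR)` a right-dual pair, all four snake identities holding. -/
structure FrobeniusDuality (ι : a ⟶ b) (κ : b ⟶ a) where
  evL : κ ≫ ι ⟶ 𝟙 b
  coevL : 𝟙 a ⟶ ι ≫ κ
  evR : ι ≫ κ ⟶ 𝟙 a
  coevR : 𝟙 b ⟶ κ ≫ ι
  zig1 : (λ_ ι).inv ≫ coevL ▷ ι ≫ (α_ ι κ ι).hom ≫ ι ◁ evL ≫ (ρ_ ι).hom = 𝟙 ι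
  zig2 : (ρ_ κ).inv ≫ κ ◁ coevL ≫ (α_ κ ι κ).inv ≫ evL ▷ κ ≫ (λ_ κ).hom = 𝟙 κ
  zig3 : (ρ_ ι).inv ≫ ι ◁ coevR ≫ (α_ ι κ ι).inv ≫ evR ▷ ι ≫ (λ_ ι).hom = 𝟙 ι
  zig4 : (λ_ κ).inv ≫ coevR ▷ κ ≫ (α_ κ ι κ).hom ≫ κ ◁ evR ≫ (ρ_ κ).hom = 𝟙 κ

namespace FrobeniusDuality

variable {ι : a ⟶ b} {κ : b ⟶ a} (D : FrobeniusDuality ι κ)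

/-- The Fourier transformation `F`, bending the legs of a 2-endomorphism of `ι ≫ κ`
using `coevR` and `evL`. -/
def Ftr (x : ι ≫ κ ⟶ ι ≫ κ) : κ ≫ ι ⟶ κ ≫ ι :=
  (λ_ (κ ≫ ι)).inv ≫ D.coevR ▷ (κ ≫ ι) ≫ (α_ κ ι (κ ≫ ι)).hom ≫
    κ ◁ ((α_ ι κ ι).inv ≫ x ▷ ι ≫ (α_ ι κ ι).hom) ≫
    (α_ κ ι (κ ≫ ι)).inv ≫ (κ ≫ ι) ◁ D.evL ≫ (ρ_ (κ ≫ ι)).hom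

/-- The inverse Fourier transformation, bending legs using `coevL` and `evR`. -/
def FtrInv (y : κ ≫ ι ⟶ κ ≫ ι) : ι ≫ κ ⟶ ι ≫ κ :=
  (ρ_ (ι ≫ κ)).inv ≫ (ι ≫ κ) ◁ D.coevL ≫ (α_ ι κ (ι ≫ κ)).hom ≫
    ι ◁ ((α_ κ ι κ).inv ≫ y ▷ κ ≫ (α_ κ ι κ).hom) ≫
    (α_ ι κ (ι ≫ κ)).inv ≫ D.evR ▷ (ι ≫ κ) ≫ (λ_ (ι ≫ κ)).hom

/-- The second Fourier transformation `Ḟ`, with `coevR` and `evL` attached on the other sides. -/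
def Fdot (x : ι ≫ κ ⟶ ι ≫ κ) : κ ≫ ι ⟶ κ ≫ ι :=
  (ρ_ (κ ≫ ι)).inv ≫ (κ ≫ ι) ◁ D.coevR ≫ (α_ κ ι (κ ≫ ι)).hom ≫
    κ ◁ ((α_ ι κ ι).inv ≫ x ▷ ι ≫ (α_ ι κ ι).hom) ≫
    (α_ κ ι (κ ≫ ι)).inv ≫ D.evL ▷ (κ ≫ ι) ≫ (λ_ (κ ≫ ι)).hom

/-- The inverse of the second Fourier transformation. -/
def FdotInv (y : κ ≫ ι ⟶ κ ≫ ι) : ι ≫ κ ⟶ ι ≫ κ :=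
  (λ_ (ι ≫ κ)).inv ≫ D.coevL ▷ (ι ≫ κ) ≫ (α_ ι κ (ι ≫ κ)).hom ≫
    ι ◁ ((α_ κ ι κ).inv ≫ y ▷ κ ≫ (α_ κ ι κ).hom) ≫
    (α_ ι κ (ι ≫ κ)).inv ≫ (ι ≫ κ) ◁ D.evR ≫ (ρ_ (ι ≫ κ)).hom

/-- The convolution product on `C²(ι×κ, ι×κ)`, contracting the middle legs with
`coevR` and `evL`.  (Vertical composition in the paper is `x ∘ y = y ≫ x`.) -/
def conv (x y : ι ≫ κ ⟶ ι ≫ κ) : ι ≫ κ ⟶ ι ≫ κ :=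
  ι ◁ (λ_ κ).inv ≫ ι ◁ (D.coevR ▷ κ) ≫ ι ◁ (α_ κ ι κ).hom ≫
    (α_ ι κ (ι ≫ κ)).inv ≫ x ▷ (ι ≫ κ) ≫ (ι ≫ κ) ◁ y ≫
    (α_ ι κ (ι ≫ κ)).hom ≫ ι ◁ (α_ κ ι κ).inv ≫ ι ◁ (D.evL ▷ κ) ≫ ι ◁ (λ_ κ).hom

/-- The convolution product on `C²(κ×ι, κ×ι)`, contracting the middle legs with
`coevL` and `evR`. -/
def convB (x y : κ ≫ ι ⟶ κ ≫ ι) : κ ≫ ι ⟶ κ ≫ ι :=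
  κ ◁ (λ_ ι).inv ≫ κ ◁ (D.coevL ▷ ι) ≫ κ ◁ (α_ ι κ ι).hom ≫
    (α_ κ ι (κ ≫ ι)).inv ≫ x ▷ (κ ≫ ι) ≫ (κ ≫ ι) ◁ y ≫
    (α_ κ ι (κ ≫ ι)).hom ≫ κ ◁ (α_ ι κ ι).inv ≫ κ ◁ (D.evR ▷ ι) ≫ κ ◁ (λ_ ι).hom

/-- The convolution unit `i_A = coev_L ∘ ev_R`. -/
def iA : ι ≫ κ ⟶ ι ≫ κ := D.evR ≫ D.coevL

/-- The convolution unit `i_B = coev_R ∘ ev_L`. -/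
def iB : κ ≫ ι ⟶ κ ≫ ι := D.evL ≫ D.coevR

/-- The antipode `S_A = Ḟ⁻¹ ∘ F`. -/
def SA (x : ι ≫ κ ⟶ ι ≫ κ) : ι ≫ κ ⟶ ι ≫ κ := D.FdotInv (D.Ftr x)

/-- The inverse antipode `S_A⁻¹ = F⁻¹ ∘ Ḟ`. -/
def SAinv (x : ι ≫ κ ⟶ ι ≫ κ) : ι ≫ κ ⟶ ι ≫ κ := D.FtrInv (D.Fdot x)

/-- The anti-isomorphism `ν : L → R^op` (conjugation with `evR`/`coevR`). -/
def nu (l : ι ⟶ ι) : κ ⟶ κ :=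
  (λ_ κ).inv ≫ D.coevR ▷ κ ≫ (α_ κ ι κ).hom ≫ κ ◁ (l ▷ κ) ≫ κ ◁ D.evR ≫ (ρ_ κ).hom

/-- The anti-isomorphism `μ : L → R^op` (conjugation with `evL`/`coevL`). -/
def mu (l : ι ⟶ ι) : κ ⟶ κ :=
  (ρ_ κ).inv ≫ κ ◁ D.coevL ≫ (α_ κ ι κ).inv ≫ (κ ◁ l) ▷ κ ≫ D.evL ▷ κ ≫ (λ_ κ).hom

/-- The Frobenius map `φ_L : A → L`. -/
def phiL (x : ι ≫ κ ⟶ ι ≫ κ) : ι ⟶ ι :=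
  (ρ_ ι).inv ≫ ι ◁ D.coevR ≫ (α_ ι κ ι).inv ≫ x ▷ ι ≫ (α_ ι κ ι).hom ≫ ι ◁ D.evL ≫ (ρ_ ι).hom

/-- Source map of the left bialgebroid `s_L : L → A`, `l ↦ l × κ`. -/
def sL (_D : FrobeniusDuality ι κ) (l : ι ⟶ ι) : ι ≫ κ ⟶ ι ≫ κ := l ▷ κ

/-- Target map of the left bialgebroid `t_L : L → A`, `l ↦ ι × μ(l)`. -/
def tL (l : ι ⟶ ι) : ι ≫ κ ⟶ ι ≫ κ := ι ◁ D.mu l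

/-- Source map of the right bialgebroid `s_R : R → A`, `r ↦ ι × r`. -/
def sR (_D : FrobeniusDuality ι κ) (r : κ ⟶ κ) : ι ≫ κ ⟶ ι ≫ κ := ι ◁ r

/-- Target map of the right bialgebroid `t_R : R → A`, `r ↦ ν⁻¹(r) × κ`. -/
noncomputable def tR (r : κ ⟶ κ) : ι ≫ κ ⟶ ι ≫ κ :=
  (@Function.invFun (ι ⟶ ι) (κ ⟶ κ) ⟨𝟙 ι⟩ D.nu r) ▷ κ

/-- The counit `π_L(a) = φ_L(a ∘ i_A)`. -/
def piL (x : ι ≫ κ ⟶ ι ≫ κ) : ι ⟶ ι := D.phiL (D.iA ≫ x)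

/-- The counit `π_R(a) = ν(φ_L(S_A⁻¹(a) ∘ i_A))`. -/
def piR (x : ι ≫ κ ⟶ ι ≫ κ) : κ ⟶ κ := D.nu (D.phiL (D.iA ≫ D.SAinv x))

/-- The composite `(y × ι) ∘ α⁻¹ ∘ (ι × coevR) ∘ (ι × evL) ∘ α ∘ (x × ι)` appearing in
the depth-2 quasi-basis identity. -/
def d2comp (x y : ι ≫ κ ⟶ ι ≫ κ) : (ι ≫ κ) ≫ ι ⟶ (ι ≫ κ) ≫ ι :=
  x ▷ ι ≫ (α_ ι κ ι).hom ≫ ι ◁ D.evL ≫ ι ◁ D.coevR ≫ (α_ ι κ ι).inv ≫ y ▷ ι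

end FrobeniusDuality


namespace FrobeniusDuality

variable {ι : a ⟶ b} {κ : b ⟶ a} (D : FrobeniusDuality ι κ)

/-- The action of the monad `ι ≫ κ` on `ι`. -/
def act : (ι ≫ κ) ≫ ι ⟶ ι := (α_ ι κ ι).hom ≫ ι ◁ D.evL ≫ (ρ_ ι).hom

/-- The multiplication of the monad `ι ≫ κ`. -/
def monadMul : (ι ≫ κ) ≫ (ι ≫ κ) ⟶ ι ≫ κ :=
  (α_ ι κ (ι ≫ κ)).hom ≫ ι ◁ ((α_ κ ι κ).inv ≫ D.evL ▷ κ ≫ (λ_ κ).hom)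

/-- The action of `ι ≫ κ` on the free module `(ι ≫ κ) ≫ ι`. -/
def freeAct : (ι ≫ κ) ≫ ((ι ≫ κ) ≫ ι) ⟶ (ι ≫ κ) ≫ ι :=
  (α_ (ι ≫ κ) (ι ≫ κ) ι).inv ≫ D.monadMul ▷ ι

/-- The transpose of `g : W ⟶ ι ≫ κ` under `ι ⊣ κ`. -/
def bend {W : a ⟶ a} (g : W ⟶ ι ≫ κ) : W ≫ ι ⟶ ι := g ▷ ι ≫ D.act

/-- A left inverse of `bend`. -/
def unbend {W : a ⟶ a} (h : W ≫ ι ⟶ ι) : W ⟶ ι ≫ κ :=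
  (ρ_ W).inv ≫ W ◁ D.coevL ≫ (α_ W ι κ).inv ≫ h ▷ κ

/-- The transpose of an endomorphism of `ι ≫ κ` bending its `κ`-input upwards. -/
def cobend (y : ι ≫ κ ⟶ ι ≫ κ) : ι ⟶ (ι ≫ κ) ≫ ι :=
  (ρ_ ι).inv ≫ ι ◁ D.coevR ≫ (α_ ι κ ι).inv ≫ y ▷ ι

/-- The Fourier transform whiskered by `ι`. -/
def whiskFtr (x : ι ≫ κ ⟶ ι ≫ κ) : (ι ≫ κ) ≫ ι ⟶ (ι ≫ κ) ≫ ι :=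
  (α_ ι κ ι).hom ≫ ι ◁ D.Ftr x ≫ (α_ ι κ ι).inv

/-- The transpose of `evR` as a map of free modules. -/
def coact : (ι ≫ κ) ≫ ι ⟶ ι := D.evR ▷ ι ≫ (λ_ ι).hom

theorem coevL_act : (λ_ ι).inv ≫ D.coevL ▷ ι ≫ D.act = 𝟙 ι := by
  simpa [act] using D.zig1

theorem unbend_bend {W : a ⟶ a} (g : W ⟶ ι ≫ κ) : D.unbend (D.bend g) = g := by
  calc
    _ = 𝟙 _ ⊗≫ (W ◁ D.coevL ≫ g ▷ (ι ≫ κ)) ⊗≫ ι ◁ D.evL ▷ κ ⊗≫ 𝟙 _ := by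
      simp only [unbend, bend, act]; bicategory
    _ = g ⊗≫ ι ◁ ((ρ_ κ).inv ≫ κ ◁ D.coevL ≫ (α_ κ ι κ).inv ≫ D.evL ▷ κ ≫ (λ_ κ).hom) := by
      rw [whisker_exchange]; bicategory
    _ = g := by rw [D.zig2]; bicategory

theorem bend_injective {W : a ⟶ a} : Function.Injective (D.bend (W := W)) :=
  Function.LeftInverse.injective D.unbend_bend

theorem bend_comp {V W : a ⟶ a} (f : V ⟶ W) (g : W ⟶ ι ≫ κ) :
    D.bend (f ≫ g) = f ▷ ι ≫ D.bend g := by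
  simp [bend]

theorem bend_comp_sL {W : a ⟶ a} (u : W ⟶ ι ≫ κ) (l : ι ⟶ ι) :
    D.bend (u ≫ D.sL l) = D.bend u ≫ l := by
  calc
    _ = u ▷ ι ⊗≫ (l ▷ (κ ≫ ι) ≫ ι ◁ D.evL) ⊗≫ 𝟙 _ := by
      simp only [bend, sL, act]; bicategory
    _ = _ := by
      rw [← whisker_exchange]; simp only [bend, act]; bicategory

theorem mu_evL (l : ι ⟶ ι) : D.mu l ▷ ι ≫ D.evL = κ ◁ l ≫ D.evL := by
  calc
    _ = 𝟙 _ ⊗≫ κ ◁ D.coevL ▷ ι ⊗≫ κ ◁ l ▷ (κ ≫ ι) ⊗≫ (D.evL ▷ (κ ≫ ι) ≫ 𝟙 b ◁ D.evL) ⊗≫ 𝟙 _ := by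
      simp only [mu]; bicategory
    _ = 𝟙 _ ⊗≫ κ ◁ D.coevL ▷ ι ⊗≫ κ ◁ (l ▷ (κ ≫ ι) ≫ ι ◁ D.evL) ⊗≫ D.evL := by
      rw [← whisker_exchange]; bicategory
    _ = κ ◁ ((λ_ ι).inv ≫ D.coevL ▷ ι ≫ (α_ ι κ ι).hom ≫ ι ◁ D.evL ≫ (ρ_ ι).hom) ⊗≫
          κ ◁ l ⊗≫ D.evL := by
      rw [← whisker_exchange]; bicategory
    _ = _ := by rw [D.zig1]; bicategory

theorem coevL_mu (l : ι ⟶ ι) : D.coevL ≫ ι ◁ D.mu l = D.coevL ≫ l ▷ κ := by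
  calc
    _ = 𝟙 _ ⊗≫ (D.coevL ▷ 𝟙 a ≫ (ι ≫ κ) ◁ D.coevL) ⊗≫ ι ◁ κ ◁ l ▷ κ ⊗≫ ι ◁ D.evL ▷ κ ⊗≫ 𝟙 _ := by
      simp only [mu]; bicategory
    _ = D.coevL ⊗≫ (D.coevL ▷ ι ≫ (ι ≫ κ) ◁ l) ▷ κ ⊗≫ ι ◁ D.evL ▷ κ ⊗≫ 𝟙 _ := by
      rw [← whisker_exchange]; bicategory
    _ = D.coevL ⊗≫ l ▷ κ ⊗≫
          ((λ_ ι).inv ≫ D.coevL ▷ ι ≫ (α_ ι κ ι).hom ≫ ι ◁ D.evL ≫ (ρ_ ι).hom) ▷ κ ⊗≫ 𝟙 _ := by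
      rw [← whisker_exchange]; bicategory
    _ = _ := by rw [D.zig1]; bicategory

theorem bend_comp_tL {W : a ⟶ a} (u : W ⟶ ι ≫ κ) (l : ι ⟶ ι) :
    D.bend (u ≫ D.tL l) = W ◁ l ≫ D.bend u := by
  calc
    _ = u ▷ ι ⊗≫ ι ◁ (D.mu l ▷ ι ≫ D.evL) ⊗≫ 𝟙 _ := by
      simp only [bend, tL, act]; bicategory
    _ = (u ▷ ι ≫ (ι ≫ κ) ◁ l) ⊗≫ ι ◁ D.evL ⊗≫ 𝟙 _ := by
      rw [mu_evL]; bicategory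
    _ = _ := by
      rw [← whisker_exchange]; simp only [bend, act]; bicategory

theorem bend_conv (x z : ι ≫ κ ⟶ ι ≫ κ) :
    D.bend (D.conv x z) = D.whiskFtr z ≫ D.bend x := by
  calc
    _ = 𝟙 _ ⊗≫ ι ◁ D.coevR ▷ (κ ≫ ι) ⊗≫ (x ▷ (ι ≫ κ) ≫ (ι ≫ κ) ◁ z) ▷ ι ⊗≫
          ι ◁ (D.evL ▷ (κ ≫ ι) ≫ 𝟙 b ◁ D.evL) ⊗≫ 𝟙 _ := by
      simp only [bend, conv, act]; bicategory
    _ = 𝟙 _ ⊗≫ ι ◁ D.coevR ▷ (κ ≫ ι) ⊗≫ (ι ≫ κ) ◁ z ▷ ι ⊗≫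
          (x ▷ (ι ≫ (κ ≫ ι)) ≫ (ι ≫ κ) ◁ (ι ◁ D.evL)) ⊗≫ ι ◁ D.evL ⊗≫ 𝟙 _ := by
      rw [← whisker_exchange, ← whisker_exchange]; bicategory
    _ = _ := by
      rw [← whisker_exchange]; simp only [bend, act, whiskFtr, Ftr]; bicategory

theorem Ftr_FtrInv (z : κ ≫ ι ⟶ κ ≫ ι) : D.Ftr (D.FtrInv z) = z := by
  calc
    _ = 𝟙 _ ⊗≫ (D.coevR ▷ (κ ≫ (𝟙 a ≫ ι)) ≫ (κ ≫ ι) ◁ (κ ◁ D.coevL ▷ ι)) ⊗≫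
          κ ◁ ι ◁ z ▷ (κ ≫ ι) ⊗≫ κ ◁ (D.evR ▷ (ι ≫ (κ ≫ ι)) ≫ 𝟙 a ◁ (ι ◁ D.evL)) ⊗≫ 𝟙 _ := by
      simp only [Ftr, FtrInv]; bicategory
    _ = 𝟙 _ ⊗≫ (κ ◁ D.coevL ▷ ι) ⊗≫ D.coevR ▷ ((κ ≫ ι) ≫ (κ ≫ ι)) ⊗≫
          κ ◁ ι ◁ (z ▷ (κ ≫ ι) ≫ (κ ≫ ι) ◁ D.evL) ⊗≫ κ ◁ D.evR ▷ ι ⊗≫ 𝟙 _ := by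
      rw [← whisker_exchange, ← whisker_exchange]; bicategory
    _ = 𝟙 _ ⊗≫ (κ ◁ D.coevL ▷ ι) ⊗≫
          (D.coevR ▷ ((κ ≫ ι) ≫ (κ ≫ ι)) ≫ (κ ≫ ι) ◁ ((κ ≫ ι) ◁ D.evL)) ⊗≫ κ ◁ ι ◁ z ⊗≫
            κ ◁ D.evR ▷ ι ⊗≫ 𝟙 _ := by
      rw [← whisker_exchange]; bicategory
    _ = 𝟙 _ ⊗≫ κ ◁ ((λ_ ι).inv ≫ D.coevL ▷ ι ≫ (α_ ι κ ι).hom ≫ ι ◁ D.evL ≫ (ρ_ ι).hom) ⊗≫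
          (D.coevR ▷ (κ ≫ ι) ≫ (κ ≫ ι) ◁ z) ⊗≫ κ ◁ D.evR ▷ ι ⊗≫ 𝟙 _ := by
      rw [← whisker_exchange]; bicategory
    _ = z ⊗≫ ((λ_ κ).inv ≫ D.coevR ▷ κ ≫ (α_ κ ι κ).hom ≫ κ ◁ D.evR ≫ (ρ_ κ).hom) ▷ ι := by
      rw [← whisker_exchange, D.zig1]; bicategory
    _ = z := by rw [D.zig4]; bicategory

theorem whiskFtr_SAinv (y : ι ≫ κ ⟶ ι ≫ κ) :
    D.whiskFtr (D.SAinv y) = (ι ≫ κ) ◁ D.cobend y ≫ D.freeAct := by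
  simp only [whiskFtr, SAinv, Ftr_FtrInv, Fdot, cobend, freeAct, monadMul]; bicategory

theorem whiskFtr_coact (z : ι ≫ κ ⟶ ι ≫ κ) : D.whiskFtr z ≫ D.coact = D.bend z := by
  calc
    _ = 𝟙 _ ⊗≫ ι ◁ D.coevR ▷ (κ ≫ ι) ⊗≫ ι ◁ κ ◁ z ▷ ι ⊗≫
          (((ι ≫ κ) ◁ (ι ◁ D.evL)) ≫ D.evR ▷ (ι ≫ 𝟙 b)) ⊗≫ 𝟙 _ := by
      simp only [whiskFtr, coact, Ftr]; bicategory
    _ = 𝟙 _ ⊗≫ ι ◁ D.coevR ▷ (κ ≫ ι) ⊗≫ ((ι ≫ κ) ◁ z ≫ D.evR ▷ (ι ≫ κ)) ▷ ι ⊗≫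
          ι ◁ D.evL ⊗≫ 𝟙 _ := by
      rw [whisker_exchange]; bicategory
    _ = ((ρ_ ι).inv ≫ ι ◁ D.coevR ≫ (α_ ι κ ι).inv ≫ D.evR ▷ ι ≫ (λ_ ι).hom) ▷ κ ▷ ι ⊗≫
          z ▷ ι ⊗≫ ι ◁ D.evL ⊗≫ 𝟙 _ := by
      rw [whisker_exchange]; bicategory
    _ = _ := by rw [D.zig3]; simp only [bend, act]; bicategory

theorem bend_SAinv (y : ι ≫ κ ⟶ ι ≫ κ) :
    D.bend (D.SAinv y) = (ι ≫ κ) ◁ D.cobend y ≫ D.freeAct ≫ D.coact := by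
  rw [← whiskFtr_coact, whiskFtr_SAinv, Category.assoc]

theorem freeAct_whiskFtr (z : ι ≫ κ ⟶ ι ≫ κ) :
    D.freeAct ≫ D.whiskFtr z = (ι ≫ κ) ◁ D.whiskFtr z ≫ D.freeAct := by
  calc
    _ = 𝟙 _ ⊗≫ ι ◁ (D.evL ▷ (κ ≫ ι) ≫ 𝟙 b ◁ D.Ftr z) ⊗≫ 𝟙 _ := by
      simp only [freeAct, monadMul, whiskFtr]; bicategory
    _ = _ := by
      rw [← whisker_exchange]; simp only [freeAct, monadMul, whiskFtr]; bicategory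

theorem d2comp_eq (x y : ι ≫ κ ⟶ ι ≫ κ) : D.d2comp x y = D.bend x ≫ D.cobend y := by
  simp [d2comp, bend, cobend, act]

theorem piL_eq (z : ι ≫ κ ⟶ ι ≫ κ) :
    D.piL z = (λ_ ι).inv ≫ D.coevL ▷ ι ≫ D.bend z := by
  calc
    _ = ((ρ_ ι).inv ≫ ι ◁ D.coevR ≫ (α_ ι κ ι).inv ≫ D.evR ▷ ι ≫ (λ_ ι).hom) ⊗≫
          D.coevL ▷ ι ≫ D.bend z := by
      simp only [piL, phiL, iA, bend, act]; bicategory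
    _ = _ := by rw [D.zig3]; bicategory

theorem freeAct_act : D.freeAct ≫ D.act = (ι ≫ κ) ◁ D.act ≫ D.act := by
  calc
    _ = 𝟙 _ ⊗≫ ι ◁ (D.evL ▷ (κ ≫ ι) ≫ 𝟙 b ◁ D.evL) ⊗≫ 𝟙 _ := by
      simp only [freeAct, monadMul, act]; bicategory
    _ = _ := by
      rw [← whisker_exchange]; simp only [act]; bicategory

theorem coevL_monadMul : (λ_ (ι ≫ κ)).inv ≫ D.coevL ▷ (ι ≫ κ) ≫ D.monadMul = 𝟙 _ := by
  calc
    _ = ((λ_ ι).inv ≫ D.coevL ▷ ι ≫ (α_ ι κ ι).hom ≫ ι ◁ D.evL ≫ (ρ_ ι).hom) ▷ κ := by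
      simp only [monadMul]; bicategory
    _ = _ := by rw [D.zig1]; simp

theorem monadMul_coevL : (ρ_ (ι ≫ κ)).inv ≫ (ι ≫ κ) ◁ D.coevL ≫ D.monadMul = 𝟙 _ := by
  calc
    _ = ι ◁ ((ρ_ κ).inv ≫ κ ◁ D.coevL ≫ (α_ κ ι κ).inv ≫ D.evL ▷ κ ≫ (λ_ κ).hom) := by
      simp only [monadMul]; bicategory
    _ = _ := by rw [D.zig2]; simp

theorem bend_coevL : D.bend D.coevL = (λ_ ι).hom := by
  rw [← cancel_epi (λ_ ι).inv, bend, coevL_act, Iso.inv_hom_id]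

theorem bend_one : D.bend (𝟙 (ι ≫ κ)) = D.act := by
  simp [bend]

theorem coevL_sL_piL (z : ι ≫ κ ⟶ ι ≫ κ) : D.coevL ≫ D.sL (D.piL z) = D.coevL ≫ z := by
  apply D.bend_injective
  rw [bend_comp_sL, bend_coevL, piL_eq, Iso.hom_inv_id_assoc, bend_comp]

theorem coevL_tL (l : ι ⟶ ι) : D.coevL ≫ D.tL l = D.coevL ≫ D.sL l :=
  D.coevL_mu l

theorem piL_comp (z' z : ι ≫ κ ⟶ ι ≫ κ) :
    D.piL (z' ≫ z) = (λ_ ι).inv ≫ (D.coevL ≫ z') ▷ ι ≫ D.bend z := by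
  rw [piL_eq, bend_comp, comp_whiskerRight_assoc]

theorem piL_one : D.piL (𝟙 (ι ≫ κ)) = 𝟙 ι := by
  rw [piL_eq, bend_one, coevL_act]

theorem tL_comp (l l' : ι ⟶ ι) : D.tL (l' ≫ l) = D.tL l ≫ D.tL l' := by
  apply D.bend_injective
  rw [bend_comp_tL, ← Category.id_comp (D.tL (l' ≫ l)), ← Category.id_comp (D.tL l),
    bend_comp_tL, bend_comp_tL, whiskerLeft_comp_assoc]

theorem tL_id : D.tL (𝟙 ι) = 𝟙 (ι ≫ κ) := by
  apply D.bend_injective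
  rw [← Category.id_comp (D.tL (𝟙 ι)), bend_comp_tL, whiskerLeft_id, Category.id_comp]

theorem freeAct_naturality (h : (ι ≫ κ) ≫ ι ⟶ ι) :
    (ι ≫ κ) ◁ (ι ≫ κ) ◁ h ≫ D.freeAct =
      (α_ (ι ≫ κ) (ι ≫ κ) _).inv ≫ D.monadMul ▷ ((ι ≫ κ) ≫ ι) ≫ (ι ≫ κ) ◁ h := by
  rw [← whisker_exchange, freeAct]; bicategory

theorem freeAct_naturality' (h : ι ⟶ ι) :
    (ι ≫ κ) ◁ (ι ≫ κ) ◁ h ≫ D.freeAct = D.freeAct ≫ (ι ≫ κ) ◁ h := by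
  rw [freeAct, Category.assoc, ← whisker_exchange]; bicategory

theorem freeAct_assoc :
    (α_ (ι ≫ κ) (ι ≫ κ) ((ι ≫ κ) ≫ ι)).inv ≫ D.monadMul ▷ ((ι ≫ κ) ≫ ι) ≫ D.freeAct =
      (ι ≫ κ) ◁ D.freeAct ≫ D.freeAct := by
  calc
    _ = 𝟙 _ ⊗≫ ι ◁ (D.evL ▷ (κ ≫ (ι ≫ (κ ≫ ι))) ≫ 𝟙 b ◁ (κ ◁ ι ◁ 𝟙 (κ ≫ ι))) ⊗≫ D.freeAct := by
      simp only [monadMul]; bicategory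
    _ = 𝟙 _ ⊗≫ ι ◁ (D.evL ▷ (κ ≫ (ι ≫ (κ ≫ ι))) ≫ 𝟙 b ◁ (𝟙 _ ⊗≫ D.evL ▷ (κ ≫ ι))) ⊗≫ 𝟙 _ := by
      simp only [freeAct, monadMul]; bicategory
    _ = _ := by
      rw [← whisker_exchange]; simp only [freeAct, monadMul]; bicategory

theorem coevL_freeAct :
    (λ_ ((ι ≫ κ) ≫ ι)).inv ≫ D.coevL ▷ ((ι ≫ κ) ≫ ι) ≫ D.freeAct = 𝟙 _ := by
  calc
    _ = ((λ_ (ι ≫ κ)).inv ≫ D.coevL ▷ (ι ≫ κ) ≫ D.monadMul) ▷ ι := by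
      simp only [freeAct]; bicategory
    _ = _ := by rw [coevL_monadMul, id_whiskerRight]

theorem whiskerLeft_coevL_freeAct :
    (ι ≫ κ) ◁ ((λ_ ι).inv ≫ D.coevL ▷ ι) ≫ D.freeAct = 𝟙 _ := by
  calc
    _ = ((ρ_ (ι ≫ κ)).inv ≫ (ι ≫ κ) ◁ D.coevL ≫ D.monadMul) ▷ ι := by
      simp only [freeAct]; bicategory
    _ = _ := by rw [monadMul_coevL, id_whiskerRight]

/-- The pairing `(ι ≫ κ) ≫ (ι ≫ κ) ≫ ι ⟶ ι` representing the tensor `u ⊗ v`. -/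
def bendTensor (u v : ι ≫ κ ⟶ ι ≫ κ) : (ι ≫ κ) ≫ ((ι ≫ κ) ≫ ι) ⟶ ι :=
  (ι ≫ κ) ◁ D.bend v ≫ D.bend u

theorem bendTensor_tL_comp (l : ι ⟶ ι) (u v : ι ≫ κ ⟶ ι ≫ κ) :
    D.bendTensor (D.tL l ≫ u) v = (ι ◁ D.mu l) ▷ ((ι ≫ κ) ≫ ι) ≫ D.bendTensor u v := by
  rw [bendTensor, bend_comp, tL, whisker_exchange_assoc, bendTensor]

theorem bendTensor_sL_comp (l : ι ⟶ ι) (u v : ι ≫ κ ⟶ ι ≫ κ) :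
    D.bendTensor u (D.sL l ≫ v) = (ι ≫ κ) ◁ ((l ▷ κ) ▷ ι) ≫ D.bendTensor u v := by
  rw [bendTensor, bend_comp, sL, whiskerLeft_comp_assoc, bendTensor]

theorem bendTensor_one : D.bendTensor (𝟙 _) (𝟙 _) = D.freeAct ≫ D.bend (𝟙 _) := by
  rw [bendTensor, bend_one, freeAct_act]

theorem tL_freeAct (l : ι ⟶ ι) :
    (ι ◁ D.mu l) ▷ ((ι ≫ κ) ≫ ι) ≫ D.freeAct = (ι ≫ κ) ◁ ((l ▷ κ) ▷ ι) ≫ D.freeAct := by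
  calc
    _ = 𝟙 _ ⊗≫ ι ◁ (D.mu l ▷ ι ≫ D.evL) ▷ κ ▷ ι ⊗≫ 𝟙 _ := by
      simp only [freeAct, monadMul]; bicategory
    _ = _ := by
      rw [mu_evL]; simp only [freeAct, monadMul]; bicategory

theorem bend_tensor_monadMul (u v : ι ≫ κ ⟶ ι ≫ κ) :
    D.bend ((ι ≫ κ) ◁ v ≫ u ▷ (ι ≫ κ) ≫ D.monadMul) = (α_ _ _ _).hom ≫ D.bendTensor u v := by
  calc
    _ = (α_ _ _ _).hom ≫ (ι ≫ κ) ◁ v ▷ ι ≫ u ▷ ((ι ≫ κ) ≫ ι) ≫ D.freeAct ≫ D.act := by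
      simp only [bend, freeAct]; bicategory
    _ = _ := by
      rw [freeAct_act, ← whisker_exchange_assoc]; simp only [bendTensor, bend]; bicategory

theorem bendTensor_comp (u u' v v' : ι ≫ κ ⟶ ι ≫ κ) :
    D.bendTensor (u ≫ u') (v ≫ v') =
      (ι ≫ κ) ◁ v ▷ ι ≫ u ▷ ((ι ≫ κ) ≫ ι) ≫ D.bendTensor u' v' := by
  simp only [bendTensor, bend_comp, whiskerLeft_comp, Category.assoc, whisker_exchange_assoc]

theorem tensor_freeAct (u v : ι ≫ κ ⟶ ι ≫ κ) :
    (ι ≫ κ) ◁ v ▷ ι ≫ u ▷ ((ι ≫ κ) ≫ ι) ≫ D.freeAct =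
      (α_ _ _ _).inv ≫ ((ι ≫ κ) ◁ v ≫ u ▷ (ι ≫ κ) ≫ D.monadMul) ▷ ι := by
  simp only [freeAct]; bicategory

theorem bend_comp_piL (u v : ι ≫ κ ⟶ ι ≫ κ) :
    D.bend v ≫ D.piL u =
      (λ_ ((ι ≫ κ) ≫ ι)).inv ≫ D.coevL ▷ ((ι ≫ κ) ≫ ι) ≫ D.bendTensor u v := by
  rw [piL_eq, bendTensor, ← whisker_exchange_assoc]; bicategory

theorem whiskerLeft_piL_comp_bend (u v : ι ≫ κ ⟶ ι ≫ κ) :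
    (ι ≫ κ) ◁ D.piL v ≫ D.bend u =
      (ι ≫ κ) ◁ ((λ_ ι).inv ≫ D.coevL ▷ ι) ≫ D.bendTensor u v := by
  rw [piL_eq, bendTensor, ← whiskerLeft_comp_assoc, Category.assoc]

section Preadditive

variable [∀ (x y : C), Preadditive (x ⟶ y)]

theorem whiskerLeft_sum
    (wl : ∀ {x y z : C} (f : x ⟶ y) {g h : y ⟶ z} (η θ : g ⟶ h),
      f ◁ (η + θ) = f ◁ η + f ◁ θ)
    {c d e : C} (f : c ⟶ d) {g h : d ⟶ e} {J : Type*} (s : Finset J) (η : J → (g ⟶ h)) :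
    f ◁ (∑ j ∈ s, η j) = ∑ j ∈ s, f ◁ η j :=
  map_sum (AddMonoidHom.mk' (fun η : g ⟶ h => f ◁ η) (wl f)) η s

theorem sum_whiskerRight
    (wr : ∀ {x y z : C} {f g : x ⟶ y} (η θ : f ⟶ g) (h : y ⟶ z),
      (η + θ) ▷ h = η ▷ h + θ ▷ h)
    {c d e : C} {f g : c ⟶ d} (h : d ⟶ e) {J : Type*} (s : Finset J) (η : J → (f ⟶ g)) :
    (∑ j ∈ s, η j) ▷ h = ∑ j ∈ s, η j ▷ h :=
  map_sum (AddMonoidHom.mk' (fun η : f ⟶ g => η ▷ h) (fun η θ => wr η θ h)) η s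

theorem bend_sum
    (wr : ∀ {x y z : C} {f g : x ⟶ y} (η θ : f ⟶ g) (h : y ⟶ z),
      (η + θ) ▷ h = η ▷ h + θ ▷ h)
    {W : a ⟶ a} {J : Type*} (s : Finset J) (g : J → (W ⟶ ι ≫ κ)) :
    D.bend (∑ j ∈ s, g j) = ∑ j ∈ s, D.bend (g j) := by
  simp only [bend, sum_whiskerRight wr, Preadditive.sum_comp]

theorem unbend_add
    (wr : ∀ {x y z : C} {f g : x ⟶ y} (η θ : f ⟶ g) (h : y ⟶ z),
      (η + θ) ▷ h = η ▷ h + θ ▷ h)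
    {W : a ⟶ a} (g h : W ≫ ι ⟶ ι) : D.unbend (g + h) = D.unbend g + D.unbend h := by
  simp only [unbend, wr, Preadditive.comp_add]

theorem piL_add
    (wr : ∀ {x y z : C} {f g : x ⟶ y} (η θ : f ⟶ g) (h : y ⟶ z),
      (η + θ) ▷ h = η ▷ h + θ ▷ h)
    (z z' : ι ≫ κ ⟶ ι ≫ κ) : D.piL (z + z') = D.piL z + D.piL z' := by
  simp only [piL_eq, bend, wr, Preadditive.comp_add, Preadditive.add_comp]

/-- A quasi-basis expands every endomorphism over `L`. -/
theorem sum_quasiBasis_sL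
    (wr : ∀ {x y z : C} {f g : x ⟶ y} (η θ : f ⟶ g) (h : y ⟶ z),
      (η + θ) ▷ h = η ▷ h + θ ▷ h)
    {n : ℕ} {y x : ℕ → (ι ≫ κ ⟶ ι ≫ κ)}
    (hqb : ∑ i ∈ Finset.range n, D.bend (x i) ≫ D.cobend (y i) = 𝟙 ((ι ≫ κ) ≫ ι))
    (v : ι ≫ κ ⟶ ι ≫ κ) :
    ∑ i ∈ Finset.range n, x i ≫ D.sL (D.cobend (y i) ≫ D.bend v) = v := by
  apply D.bend_injective
  rw [D.bend_sum wr]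
  simp only [bend_comp_sL, ← Category.assoc]
  rw [← Preadditive.sum_comp, hqb, Category.id_comp]

/-- A balanced biadditive map factors additively through `bendTensor`. -/
theorem exists_factor_bendTensor
    (wr : ∀ {x y z : C} {f g : x ⟶ y} (η θ : f ⟶ g) (h : y ⟶ z),
      (η + θ) ▷ h = η ▷ h + θ ▷ h)
    {n : ℕ} {y x : ℕ → (ι ≫ κ ⟶ ι ≫ κ)}
    (hqb : ∑ i ∈ Finset.range n, D.bend (x i) ≫ D.cobend (y i) = 𝟙 ((ι ≫ κ) ≫ ι))
    {M : Type*} [AddCommGroup M] (f : (ι ≫ κ ⟶ ι ≫ κ) → (ι ≫ κ ⟶ ι ≫ κ) → M)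
    (hf₁ : ∀ u u' v, f (u + u') v = f u v + f u' v)
    (hf₂ : ∀ u v v', f u (v + v') = f u v + f u v')
    (hf₃ : ∀ (l : ι ⟶ ι) u v, f (u ≫ D.tL l) v = f u (v ≫ D.sL l)) :
    ∃ ψ : ((ι ≫ κ) ≫ ((ι ≫ κ) ≫ ι) ⟶ ι) →+ M, ∀ u v, f u v = ψ (D.bendTensor u v) := by
  refine ⟨AddMonoidHom.mk' (fun w => ∑ i ∈ Finset.range n,
    f (D.unbend ((ι ≫ κ) ◁ D.cobend (y i) ≫ w)) (x i)) fun w w' => ?_, fun u v => ?_⟩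
  · simp only [Preadditive.comp_add, D.unbend_add wr, hf₁, Finset.sum_add_distrib]
  · conv_lhs => rw [← D.sum_quasiBasis_sL wr hqb v]
    refine (map_sum (AddMonoidHom.mk' (f u) (hf₂ u)) _ _).trans (Finset.sum_congr rfl fun i _ => ?_)
    rw [AddMonoidHom.mk'_apply, ← hf₃, bendTensor, ← whiskerLeft_comp_assoc, ← bend_comp_tL,
      unbend_bend]

/-- A balanced triadditive map factors additively through the threefold pairing. -/
theorem exists_factor_bendTensor₃
    (wr : ∀ {x y z : C} {f g : x ⟶ y} (η θ : f ⟶ g) (h : y ⟶ z),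
      (η + θ) ▷ h = η ▷ h + θ ▷ h)
    {n : ℕ} {y x : ℕ → (ι ≫ κ ⟶ ι ≫ κ)}
    (hqb : ∑ i ∈ Finset.range n, D.bend (x i) ≫ D.cobend (y i) = 𝟙 ((ι ≫ κ) ≫ ι))
    {M : Type*} [AddCommGroup M]
    (g : (ι ≫ κ ⟶ ι ≫ κ) → (ι ≫ κ ⟶ ι ≫ κ) → (ι ≫ κ ⟶ ι ≫ κ) → M)
    (hg₁ : ∀ u u' v w', g (u + u') v w' = g u v w' + g u' v w')
    (hg₂ : ∀ u v v' w', g u (v + v') w' = g u v w' + g u v' w')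
    (hg₃ : ∀ u v w' w'', g u v (w' + w'') = g u v w' + g u v w'')
    (hg₄ : ∀ (l : ι ⟶ ι) u v w', g (u ≫ D.tL l) v w' = g u (v ≫ D.sL l) w')
    (hg₅ : ∀ (l : ι ⟶ ι) u v w', g u (v ≫ D.tL l) w' = g u v (w' ≫ D.sL l)) :
    ∃ ψ : ((ι ≫ κ) ≫ ((ι ≫ κ) ≫ ((ι ≫ κ) ≫ ι)) ⟶ ι) →+ M,
      ∀ u v t, g u v t = ψ ((ι ≫ κ) ◁ (ι ≫ κ) ◁ D.bend t ≫ D.bendTensor u v) := by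
  choose ψ hψ using fun i => D.exists_factor_bendTensor wr hqb (fun u v => g u v (x i))
    (fun u u' v => hg₁ u u' v _) (fun u v v' => hg₂ u v v' _) (fun l u v => hg₄ l u v _)
  refine ⟨AddMonoidHom.mk' (fun w => ∑ i ∈ Finset.range n,
    ψ i ((ι ≫ κ) ◁ (ι ≫ κ) ◁ D.cobend (y i) ≫ w)) fun w w' => ?_, fun u v t => ?_⟩
  · simp only [Preadditive.comp_add, map_add, Finset.sum_add_distrib]
  · conv_lhs => rw [← D.sum_quasiBasis_sL wr hqb t]
    refine (map_sum (AddMonoidHom.mk' (g u v) (hg₃ u v)) _ _).trans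
      (Finset.sum_congr rfl fun i _ => ?_)
    rw [AddMonoidHom.mk'_apply, ← hg₅, hψ, bendTensor, bend_comp_tL, bendTensor]
    simp only [whiskerLeft_comp, Category.assoc]

/-- The pairing representing the coproduct of `z`. -/
theorem sum_bendTensor_coproduct
    (wl : ∀ {x y z : C} (f : x ⟶ y) {g h : y ⟶ z} (η θ : g ⟶ h),
      f ◁ (η + θ) = f ◁ η + f ◁ θ)
    {n : ℕ} {y x : ℕ → (ι ≫ κ ⟶ ι ≫ κ)}
    (hqb : ∑ i ∈ Finset.range n, D.bend (x i) ≫ D.cobend (y i) = 𝟙 ((ι ≫ κ) ≫ ι))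
    (z : ι ≫ κ ⟶ ι ≫ κ) :
    ∑ i ∈ Finset.range n, D.bendTensor (D.SAinv (y i)) (D.conv (x i) z) =
      D.freeAct ≫ D.bend z := by
  have h (i : ℕ) : D.bendTensor (D.SAinv (y i)) (D.conv (x i) z) =
      (ι ≫ κ) ◁ D.whiskFtr z ≫ (ι ≫ κ) ◁ (D.bend (x i) ≫ D.cobend (y i)) ≫
        D.freeAct ≫ D.coact := by
    simp only [bendTensor, bend_conv, bend_SAinv, whiskerLeft_comp, Category.assoc]
  simp only [h]
  rw [← Preadditive.comp_sum, ← Preadditive.sum_comp, ← whiskerLeft_sum wl, hqb, whiskerLeft_id,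
    Category.id_comp, ← Category.assoc, ← freeAct_whiskFtr, Category.assoc, whiskFtr_coact]

theorem sum_bendTensor_coproduct'
    (wl : ∀ {x y z : C} (f : x ⟶ y) {g h : y ⟶ z} (η θ : g ⟶ h),
      f ◁ (η + θ) = f ◁ η + f ◁ θ)
    {n : ℕ} {y x : ℕ → (ι ≫ κ ⟶ ι ≫ κ)}
    (hqb : ∑ i ∈ Finset.range n, D.bend (x i) ≫ D.cobend (y i) = 𝟙 ((ι ≫ κ) ≫ ι))
    (z : ι ≫ κ ⟶ ι ≫ κ) :
    ∑ i ∈ Finset.range n, D.bendTensor (D.conv z (D.SAinv (y i))) (x i) =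
      D.freeAct ≫ D.bend z := by
  have h (i : ℕ) : D.bendTensor (D.conv z (D.SAinv (y i))) (x i) =
      (ι ≫ κ) ◁ (D.bend (x i) ≫ D.cobend (y i)) ≫ D.freeAct ≫ D.bend z := by
    simp only [bendTensor, bend_conv, whiskFtr_SAinv, whiskerLeft_comp, Category.assoc]
  simp only [h]
  rw [← Preadditive.sum_comp, ← whiskerLeft_sum wl, hqb, whiskerLeft_id, Category.id_comp]

/-- The coproduct intertwines the monad multiplication. -/
theorem sum_tensor_monadMul
    (wl : ∀ {x y z : C} (f : x ⟶ y) {g h : y ⟶ z} (η θ : g ⟶ h),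
      f ◁ (η + θ) = f ◁ η + f ◁ θ)
    (wr : ∀ {x y z : C} {f g : x ⟶ y} (η θ : f ⟶ g) (h : y ⟶ z),
      (η + θ) ▷ h = η ▷ h + θ ▷ h)
    {n : ℕ} {y x : ℕ → (ι ≫ κ ⟶ ι ≫ κ)}
    (hqb : ∑ i ∈ Finset.range n, D.bend (x i) ≫ D.cobend (y i) = 𝟙 ((ι ≫ κ) ≫ ι))
    (z : ι ≫ κ ⟶ ι ≫ κ) :
    ∑ i ∈ Finset.range n, (ι ≫ κ) ◁ D.conv (x i) z ≫ D.SAinv (y i) ▷ (ι ≫ κ) ≫ D.monadMul =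
      D.monadMul ≫ z := by
  apply D.bend_injective
  rw [D.bend_sum wr]
  simp only [bend_tensor_monadMul]
  rw [← Preadditive.comp_sum, D.sum_bendTensor_coproduct wl hqb, bend_comp, freeAct,
    Category.assoc, Iso.hom_inv_id_assoc]

end Preadditive

end FrobeniusDuality

open FrobeniusDuality in
/-- For a D2 Frobenius 1-morphism `ι` with quasi-basis `∑ᵢ yᵢ ⊗ xᵢ`, the ring
`A = C²(ι×κ, ι×κ)` carries a left bialgebroid structure over `L = C²(ι,ι)` with source
`s_L(l) = l×κ`, target `t_L(l) = ι×μ(l)`, coproduct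
`γ_L(a) = ∑ᵢ S_A⁻¹(yᵢ) ⊗ (xᵢ ∗ a) = ∑ᵢ (a ∗ S_A⁻¹(yᵢ)) ⊗ xᵢ` and counit `π_L(a) = φ_L(a∘i_A)`.
Equalities in `A_L ⊗_L {}_L A` (with `l·a·l' = s_L(l) t_L(l') a`) are expressed by evaluation
against all `L`-balanced biadditive maps.  The ring product of the paper is `u ∘ v = v ≫ u`. -/
theorem left_bialgebroid_structure
    {C : Type u} [Bicategory.{w, v} C] [∀ (x y : C), Preadditive (x ⟶ y)]
    (wl : ∀ {x y z : C} (f : x ⟶ y) {g h : y ⟶ z} (η θ : g ⟶ h),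
      f ◁ (η + θ) = f ◁ η + f ◁ θ)
    (wr : ∀ {x y z : C} {f g : x ⟶ y} (η θ : f ⟶ g) (h : y ⟶ z),
      (η + θ) ▷ h = η ▷ h + θ ▷ h)
    {a b : C} {ι : a ⟶ b} {κ : b ⟶ a} (D : FrobeniusDuality ι κ)
    (n : ℕ) (y x : ℕ → (ι ≫ κ ⟶ ι ≫ κ))
    (hqb : ∑ i ∈ Finset.range n, D.d2comp (x i) (y i) = 𝟙 ((ι ≫ κ) ≫ ι)) :
    -- `s_L` is a ring homomorphism and `t_L` an anti-homomorphism with commuting images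
    (∀ l l' : ι ⟶ ι, D.sL (l ≫ l') = D.sL l ≫ D.sL l') ∧ D.sL (𝟙 ι) = 𝟙 (ι ≫ κ) ∧
    (∀ l l' : ι ⟶ ι, D.tL (l' ≫ l) = D.tL l ≫ D.tL l') ∧ D.tL (𝟙 ι) = 𝟙 (ι ≫ κ) ∧
    (∀ l l' : ι ⟶ ι, D.sL l ≫ D.tL l' = D.tL l' ≫ D.sL l) ∧
    -- statements about the coproduct, via balanced biadditive maps
    (∀ (M : Type w) (_ : AddCommGroup M) (f : (ι ≫ κ ⟶ ι ≫ κ) → (ι ≫ κ ⟶ ι ≫ κ) → M),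
      (∀ u u' v, f (u + u') v = f u v + f u' v) →
      (∀ u v v', f u (v + v') = f u v + f u v') →
      (∀ (l : ι ⟶ ι) u v, f (u ≫ D.tL l) v = f u (v ≫ D.sL l)) →
      -- the two expressions for `γ_L` agree
      (∀ z, ∑ i ∈ Finset.range n, f (D.SAinv (y i)) (D.conv (x i) z) =
        ∑ i ∈ Finset.range n, f (D.conv z (D.SAinv (y i))) (x i)) ∧
      -- `γ_L` is an `L`-`L` bimodule map
      (∀ (l l' : ι ⟶ ι) z,
        ∑ i ∈ Finset.range n,
            f (D.SAinv (y i)) (D.conv (x i) (z ≫ D.tL l' ≫ D.sL l)) =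
        ∑ i ∈ Finset.range n,
            f (D.SAinv (y i) ≫ D.sL l) (D.conv (x i) z ≫ D.tL l')) ∧
      -- Takeuchi compatibility `a₍₁₎ t_L(l) ⊗ a₍₂₎ = a₍₁₎ ⊗ a₍₂₎ s_L(l)`
      (∀ (l : ι ⟶ ι) z,
        ∑ i ∈ Finset.range n, f (D.tL l ≫ D.SAinv (y i)) (D.conv (x i) z) =
        ∑ i ∈ Finset.range n, f (D.SAinv (y i)) (D.sL l ≫ D.conv (x i) z)) ∧
      -- `γ_L(1) = 1 ⊗ 1`
      (∑ i ∈ Finset.range n, f (D.SAinv (y i)) (D.conv (x i) (𝟙 (ι ≫ κ))) =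
        f (𝟙 (ι ≫ κ)) (𝟙 (ι ≫ κ))) ∧
      -- `γ_L` is multiplicative
      (∀ z z', ∑ i ∈ Finset.range n, f (D.SAinv (y i)) (D.conv (x i) (z' ≫ z)) =
        ∑ i ∈ Finset.range n, ∑ j ∈ Finset.range n,
          f (D.SAinv (y j) ≫ D.SAinv (y i)) (D.conv (x j) z' ≫ D.conv (x i) z))) ∧
    -- coassociativity of `γ_L`
    (∀ (M : Type w) (_ : AddCommGroup M)
      (g : (ι ≫ κ ⟶ ι ≫ κ) → (ι ≫ κ ⟶ ι ≫ κ) → (ι ≫ κ ⟶ ι ≫ κ) → M),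
      (∀ u u' v w', g (u + u') v w' = g u v w' + g u' v w') →
      (∀ u v v' w', g u (v + v') w' = g u v w' + g u v' w') →
      (∀ u v w' w'', g u v (w' + w'') = g u v w' + g u v w'') →
      (∀ (l : ι ⟶ ι) u v w', g (u ≫ D.tL l) v w' = g u (v ≫ D.sL l) w') →
      (∀ (l : ι ⟶ ι) u v w', g u (v ≫ D.tL l) w' = g u v (w' ≫ D.sL l)) →
      ∀ z, ∑ i ∈ Finset.range n, ∑ j ∈ Finset.range n,
          g (D.SAinv (y j)) (D.conv (x j) (D.SAinv (y i))) (D.conv (x i) z) =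
        ∑ i ∈ Finset.range n, ∑ j ∈ Finset.range n,
          g (D.SAinv (y i)) (D.SAinv (y j)) (D.conv (x j) (D.conv (x i) z))) ∧
    -- `π_L` is additive, unital and a counit for `γ_L`
    (∀ z z' : ι ≫ κ ⟶ ι ≫ κ, D.piL (z + z') = D.piL z + D.piL z') ∧
    D.piL (𝟙 (ι ≫ κ)) = 𝟙 ι ∧
    (∀ z : ι ≫ κ ⟶ ι ≫ κ,
      ∑ i ∈ Finset.range n, (D.conv (x i) z ≫ D.sL (D.piL (D.SAinv (y i)))) = z) ∧
    (∀ z : ι ≫ κ ⟶ ι ≫ κ,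
      ∑ i ∈ Finset.range n, (D.SAinv (y i) ≫ D.tL (D.piL (D.conv (x i) z))) = z) ∧
    -- the counit conditions `π_L(a s_L(π_L b)) = π_L(ab) = π_L(a t_L(π_L b))`
    (∀ z z' : ι ≫ κ ⟶ ι ≫ κ, D.piL (D.sL (D.piL z') ≫ z) = D.piL (z' ≫ z)) ∧
    (∀ z z' : ι ≫ κ ⟶ ι ≫ κ, D.piL (D.tL (D.piL z') ≫ z) = D.piL (z' ≫ z)) := by
  have hq : ∑ i ∈ Finset.range n, D.bend (x i) ≫ D.cobend (y i) = 𝟙 ((ι ≫ κ) ≫ ι) := by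
    simpa only [d2comp_eq] using hqb
  have hT := D.sum_bendTensor_coproduct wl hq
  refine ⟨fun l l' => comp_whiskerRight l l' κ, id_whiskerRight ι κ, D.tL_comp, D.tL_id,
    fun l l' => (whisker_exchange l (D.mu l')).symm, ?_, ?_, D.piL_add wr, D.piL_one,
    fun z => ?_, fun z => ?_, fun z z' => ?_, fun z z' => ?_⟩
  · intro M _ f hf₁ hf₂ hf₃
    obtain ⟨ψ, hψ⟩ := D.exists_factor_bendTensor wr hq f hf₁ hf₂ hf₃
    simp only [hψ, ← map_sum]
    refine ⟨fun z => ?_, fun l l' z => ?_, fun l z => ?_, ?_, fun z z' => ?_⟩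
    · rw [hT, D.sum_bendTensor_coproduct' wl hq]
    · have h (i : ℕ) : D.bendTensor (D.SAinv (y i) ≫ D.sL l) (D.conv (x i) z ≫ D.tL l') =
          (ι ≫ κ) ◁ (ι ≫ κ) ◁ l' ≫ D.bendTensor (D.SAinv (y i)) (D.conv (x i) z) ≫ l := by
        simp only [bendTensor, bend_comp_sL, bend_comp_tL, whiskerLeft_comp, Category.assoc]
      simp only [h]
      rw [← Preadditive.comp_sum, ← Preadditive.sum_comp, hT, hT, ← Category.assoc z,
        bend_comp_sL, bend_comp_tL]
      simp only [← Category.assoc, freeAct_naturality']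
    · simp only [bendTensor_tL_comp, bendTensor_sL_comp]
      rw [← Preadditive.comp_sum, ← Preadditive.comp_sum, hT, ← Category.assoc, tL_freeAct,
        Category.assoc]
    · rw [hT, bendTensor_one]
    · rw [hT, Finset.sum_comm]
      simp only [bendTensor_comp, ← Preadditive.comp_sum, hT]
      congr 1
      have h (j : ℕ) : (ι ≫ κ) ◁ D.conv (x j) z' ▷ ι ≫ D.SAinv (y j) ▷ ((ι ≫ κ) ≫ ι) ≫
          D.freeAct ≫ D.bend z = (α_ _ _ _).inv ≫ ((ι ≫ κ) ◁ D.conv (x j) z' ≫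
            D.SAinv (y j) ▷ (ι ≫ κ) ≫ D.monadMul) ▷ ι ≫ D.bend z := by
        rw [← Category.assoc (α_ _ _ _).inv, ← tensor_freeAct]
        simp only [Category.assoc]
      simp only [h]
      rw [← Preadditive.comp_sum, ← Preadditive.sum_comp, ← sum_whiskerRight wr,
        D.sum_tensor_monadMul wl wr hq, bend_comp, freeAct]
      simp only [comp_whiskerRight, Category.assoc]
  · intro M _ g hg₁ hg₂ hg₃ hg₄ hg₅ z
    obtain ⟨ψ, hψ⟩ := D.exists_factor_bendTensor₃ wr hq g hg₁ hg₂ hg₃ hg₄ hg₅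
    simp only [hψ, ← map_sum]
    have h (i j : ℕ) : (ι ≫ κ) ◁ (ι ≫ κ) ◁ D.bend (D.conv (x j) (D.conv (x i) z)) ≫
        D.bendTensor (D.SAinv (y i)) (D.SAinv (y j)) =
        (ι ≫ κ) ◁ D.bendTensor (D.SAinv (y j)) (D.conv (x j) (D.conv (x i) z)) ≫
          D.bend (D.SAinv (y i)) := by
      simp only [bendTensor, whiskerLeft_comp, Category.assoc]
    simp only [h, ← Preadditive.comp_sum, ← Preadditive.sum_comp, ← whiskerLeft_sum wl, hT]
    have h' (i : ℕ) : (ι ≫ κ) ◁ (ι ≫ κ) ◁ D.bend (D.conv (x i) z) ≫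
        D.freeAct ≫ D.bend (D.SAinv (y i)) =
        ((α_ (ι ≫ κ) (ι ≫ κ) ((ι ≫ κ) ≫ ι)).inv ≫ D.monadMul ▷ ((ι ≫ κ) ≫ ι)) ≫
          D.bendTensor (D.SAinv (y i)) (D.conv (x i) z) := by
      rw [← Category.assoc, freeAct_naturality]
      simp only [bendTensor, Category.assoc]
    have h'' (i : ℕ) : (ι ≫ κ) ◁ (D.freeAct ≫ D.bend (D.conv (x i) z)) ≫
        D.bend (D.SAinv (y i)) =
        (ι ≫ κ) ◁ D.freeAct ≫ D.bendTensor (D.SAinv (y i)) (D.conv (x i) z) := by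
      simp only [bendTensor, whiskerLeft_comp, Category.assoc]
    simp only [h', h'', ← Preadditive.comp_sum, hT]
    congr 1
    rw [← Category.assoc, Category.assoc _ _ D.freeAct, freeAct_assoc, Category.assoc]
  · apply D.bend_injective
    rw [D.bend_sum wr]
    simp only [bend_comp_sL, bend_comp_piL]
    rw [← Preadditive.comp_sum, ← Preadditive.comp_sum, hT]
    simpa only [Category.assoc, Category.id_comp] using
      congrArg (· ≫ D.bend z) D.coevL_freeAct
  · apply D.bend_injective
    rw [D.bend_sum wr]
    simp only [bend_comp_tL, whiskerLeft_piL_comp_bend]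
    rw [← Preadditive.comp_sum, hT, ← Category.assoc, whiskerLeft_coevL_freeAct,
      Category.id_comp]
  · rw [piL_comp, coevL_sL_piL, piL_comp]
  · rw [piL_comp, coevL_tL, coevL_sL_piL, piL_comp]
end

section
/- For a D2 Frobenius 1-morphism ι in an additive bicategory, the left bialgebroid structure A_L over L, the right bialgebroid structure A_R over R (given by γ_R(a) = ∑ᵢ (a ∗ S_A(xᵢ)) ⊗ yᵢ, π_R(a) = ν(φ_L(S_A⁻¹(a)∘i_A)), s_R(r)=ι×r, t_R(r)=ν⁻¹(r)×ῑ), and the antipode S_A = Ḟ⁻¹∘F together form a Hopf algebroid: s_L(L)=t_R(R) and t_L(L)=s_R(R) as subrings, the mixed coassociativity identities (γ_L⊗id)∘γ_R = (id⊗γ_R)∘γ_L and (γ_R⊗id)∘γ_L = (id⊗γ_L)∘γ_R hold, S_A is a bijective twisted bimodule map, and S_A(a₍₁₎)∘a₍₂₎ = s_R(π_R(a)), a⁽¹⁾∘S_A(a⁽²⁾) = s_L(π_L(a)) for all a ∈ A. -/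
open CategoryTheory Bicategory

universe w v u

variable {C : Type u} [Bicategory.{w, v} C] {a b : C}

namespace FrobeniusDuality

variable {ι : a ⟶ b} {κ : b ⟶ a} (D : FrobeniusDuality ι κ) {c : C}

/-- The action of a 2-endomorphism of `ι ≫ κ` on a 1-morphism `X`. -/
def actA (x : ι ≫ κ ⟶ ι ≫ κ) (X : c ⟶ a) : (X ≫ ι) ≫ κ ⟶ (X ≫ ι) ≫ κ :=
  (α_ X ι κ).hom ≫ X ◁ x ≫ (α_ X ι κ).inv

/-- The unit `coevL` acting on a 1-morphism. -/
def cL (X : c ⟶ a) : X ⟶ (X ≫ ι) ≫ κ := (ρ_ X).inv ≫ X ◁ D.coevL ≫ (α_ X ι κ).inv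

/-- The counit `evR` acting on a 1-morphism. -/
def eR (X : c ⟶ a) : (X ≫ ι) ≫ κ ⟶ X := (α_ X ι κ).hom ≫ X ◁ D.evR ≫ (ρ_ X).hom

/-- The unit `coevR` acting on a 1-morphism. -/
def cR (X : c ⟶ b) : X ⟶ (X ≫ κ) ≫ ι := (ρ_ X).inv ≫ X ◁ D.coevR ≫ (α_ X κ ι).inv

/-- The counit `evL` acting on a 1-morphism. -/
def eL (X : c ⟶ b) : (X ≫ κ) ≫ ι ⟶ X := (α_ X κ ι).hom ≫ X ◁ D.evL ≫ (ρ_ X).hom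

theorem whiskerLeft_one_injective {x y : C} {f g : x ⟶ y} {η θ : f ⟶ g}
    (h : 𝟙 x ◁ η = 𝟙 x ◁ θ) : η = θ := by
  simpa using h

theorem actA_injective {x y : ι ≫ κ ⟶ ι ≫ κ}
    (h : ∀ X : a ⟶ a, actA x X = actA y X) : x = y := by
  have := h (𝟙 a)
  simp only [actA, cancel_epi, cancel_mono] at this
  exact whiskerLeft_one_injective this

theorem actA_naturality (x : ι ≫ κ ⟶ ι ≫ κ) {X Y : c ⟶ a} (f : X ⟶ Y) :
    f ▷ ι ▷ κ ≫ actA x Y = actA x X ≫ f ▷ ι ▷ κ := by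
  simp only [actA, Category.assoc, associator_naturality_left_assoc, ← whisker_exchange_assoc,
    associator_inv_naturality_left]

theorem actA_naturality_assoc (x : ι ≫ κ ⟶ ι ≫ κ) {X Y : c ⟶ a} (f : X ⟶ Y) {Z : c ⟶ a}
    (h : (Y ≫ ι) ≫ κ ⟶ Z) :
    f ▷ ι ▷ κ ≫ actA x Y ≫ h = actA x X ≫ f ▷ ι ▷ κ ≫ h := by
  rw [← Category.assoc, actA_naturality, Category.assoc]

theorem cL_naturality {X Y : c ⟶ a} (f : X ⟶ Y) :
    f ≫ D.cL Y = D.cL X ≫ f ▷ ι ▷ κ := by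
  simp only [cL, Category.assoc, rightUnitor_inv_naturality_assoc, ← whisker_exchange_assoc,
    associator_inv_naturality_left]

theorem cL_naturality_assoc {X Y : c ⟶ a} (f : X ⟶ Y) {Z : c ⟶ a} (h : (Y ≫ ι) ≫ κ ⟶ Z) :
    f ≫ D.cL Y ≫ h = D.cL X ≫ f ▷ ι ▷ κ ≫ h := by
  rw [← Category.assoc, cL_naturality, Category.assoc]

theorem cR_naturality {X Y : c ⟶ b} (f : X ⟶ Y) :
    f ≫ D.cR Y = D.cR X ≫ f ▷ κ ▷ ι := by
  simp only [cR, Category.assoc, rightUnitor_inv_naturality_assoc, ← whisker_exchange_assoc,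
    associator_inv_naturality_left]

theorem cR_naturality_assoc {X Y : c ⟶ b} (f : X ⟶ Y) {Z : c ⟶ b} (h : (Y ≫ κ) ≫ ι ⟶ Z) :
    f ≫ D.cR Y ≫ h = D.cR X ≫ f ▷ κ ▷ ι ≫ h := by
  rw [← Category.assoc, cR_naturality, Category.assoc]

theorem eL_naturality {X Y : c ⟶ b} (f : X ⟶ Y) :
    f ▷ κ ▷ ι ≫ D.eL Y = D.eL X ≫ f := by
  simp only [eL, Category.assoc, associator_naturality_left_assoc, ← whisker_exchange_assoc,
    rightUnitor_naturality]

theorem eL_naturality_assoc {X Y : c ⟶ b} (f : X ⟶ Y) {Z : c ⟶ b} (h : Y ⟶ Z) :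
    f ▷ κ ▷ ι ≫ D.eL Y ≫ h = D.eL X ≫ f ≫ h := by
  rw [← Category.assoc, eL_naturality, Category.assoc]

theorem eR_naturality {X Y : c ⟶ a} (f : X ⟶ Y) :
    f ▷ ι ▷ κ ≫ D.eR Y = D.eR X ≫ f := by
  simp only [eR, Category.assoc, associator_naturality_left_assoc, ← whisker_exchange_assoc,
    rightUnitor_naturality]

theorem cL_eL (X : c ⟶ a) : D.cL X ▷ ι ≫ D.eL (X ≫ ι) = 𝟙 (X ≫ ι) := by
  rw [← whiskerLeft_id, ← D.zig1, cL, eL]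
  bicategory

theorem cL_eL_assoc (X : c ⟶ a) {Z : c ⟶ b} (h : X ≫ ι ⟶ Z) :
    D.cL X ▷ ι ≫ D.eL (X ≫ ι) ≫ h = h := by
  rw [← Category.assoc, cL_eL, Category.id_comp]

theorem cL_eL' (X : c ⟶ b) : D.cL (X ≫ κ) ≫ D.eL X ▷ κ = 𝟙 (X ≫ κ) := by
  rw [← whiskerLeft_id, ← D.zig2, cL, eL]
  bicategory

theorem cL_eL'_assoc (X : c ⟶ b) {Z : c ⟶ a} (h : X ≫ κ ⟶ Z) :
    D.cL (X ≫ κ) ≫ D.eL X ▷ κ ≫ h = h := by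
  rw [← Category.assoc, cL_eL', Category.id_comp]

theorem cR_eR (X : c ⟶ a) : D.cR (X ≫ ι) ≫ D.eR X ▷ ι = 𝟙 (X ≫ ι) := by
  rw [← whiskerLeft_id, ← D.zig3, cR, eR]
  bicategory

theorem cR_eR_assoc (X : c ⟶ a) {Z : c ⟶ b} (h : X ≫ ι ⟶ Z) :
    D.cR (X ≫ ι) ≫ D.eR X ▷ ι ≫ h = h := by
  rw [← Category.assoc, cR_eR, Category.id_comp]

theorem cR_eR' (X : c ⟶ b) : D.cR X ▷ κ ≫ D.eR (X ≫ κ) = 𝟙 (X ≫ κ) := by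
  rw [← whiskerLeft_id, ← D.zig4, cR, eR]
  bicategory

theorem cR_eR'_assoc (X : c ⟶ b) {Z : c ⟶ a} (h : X ≫ κ ⟶ Z) :
    D.cR X ▷ κ ≫ D.eR (X ≫ κ) ≫ h = h := by
  rw [← Category.assoc, cR_eR', Category.id_comp]

theorem actA_comp (x y : ι ≫ κ ⟶ ι ≫ κ) (X : c ⟶ a) :
    actA (x ≫ y) X = actA x X ≫ actA y X := by
  simp [actA]

theorem actA_iA (X : c ⟶ a) : actA D.iA X = D.eR X ≫ D.cL X := by
  simp [actA, iA, eR, cL]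

theorem actA_whiskerRight (l : ι ⟶ ι) (X : c ⟶ a) : actA (l ▷ κ) X = (X ◁ l) ▷ κ := by
  simp [actA]

theorem actA_whiskerLeft (r : κ ⟶ κ) (X : c ⟶ a) : actA (ι ◁ r) X = (X ≫ ι) ◁ r := by
  simp [actA]

theorem whiskerLeft_phiL (x : ι ≫ κ ⟶ ι ≫ κ) (X : c ⟶ a) :
    X ◁ D.phiL x = D.cR (X ≫ ι) ≫ actA x X ▷ ι ≫ D.eL (X ≫ ι) := by
  simp only [actA, cR, eL, phiL]
  bicategory

theorem whiskerLeft_nu (l : ι ⟶ ι) (X : c ⟶ b) :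
    X ◁ D.nu l = D.cR X ▷ κ ≫ ((X ≫ κ) ◁ l) ▷ κ ≫ D.eR (X ≫ κ) := by
  simp only [cR, eR, nu]
  bicategory

theorem whiskerLeft_mu (l : ι ⟶ ι) (X : c ⟶ b) :
    X ◁ D.mu l = D.cL (X ≫ κ) ≫ ((X ≫ κ) ◁ l) ▷ κ ≫ D.eL X ▷ κ := by
  simp only [cL, eL, mu]
  bicategory

theorem actA_conv (x y : ι ≫ κ ⟶ ι ≫ κ) (X : c ⟶ a) :
    actA (D.conv x y) X = D.cR (X ≫ ι) ▷ κ ≫ actA x X ▷ ι ▷ κ ≫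
      actA y ((X ≫ ι) ≫ κ) ≫ D.eL (X ≫ ι) ▷ κ := by
  simp only [actA, cR, eL, conv]
  bicategory

theorem actA_SA (x : ι ≫ κ ⟶ ι ≫ κ) (X : c ⟶ a) :
    actA (D.SA x) X = D.cL X ▷ ι ▷ κ ≫ D.cR (X ≫ ι) ▷ κ ▷ ι ▷ κ ≫
      actA x ((X ≫ ι) ≫ κ) ▷ ι ▷ κ ≫ D.eL (((X ≫ ι) ≫ κ) ≫ ι) ▷ κ ≫ D.eR ((X ≫ ι) ≫ κ) := by
  simp only [actA, cR, cL, eL, eR, SA, Ftr, FdotInv]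
  bicategory

theorem actA_SAinv (x : ι ≫ κ ⟶ ι ≫ κ) (X : c ⟶ a) :
    actA (D.SAinv x) X = D.cL ((X ≫ ι) ≫ κ) ≫ D.cR (((X ≫ ι) ≫ κ) ≫ ι) ▷ κ ≫
      actA x ((X ≫ ι) ≫ κ) ▷ ι ▷ κ ≫ D.eL (X ≫ ι) ▷ κ ▷ ι ▷ κ ≫ D.eR X ▷ ι ▷ κ := by
  simp only [actA, cR, cL, eL, eR, SAinv, Fdot, FtrInv]
  bicategory

/-- The nested cap pairing `ι ≫ κ` with itself. -/
def cap (X : c ⟶ a) : (((X ≫ ι) ≫ κ) ≫ ι) ≫ κ ⟶ X := D.eL (X ≫ ι) ▷ κ ≫ D.eR X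

/-- The nested cup dual to `cap`. -/
def cup (X : c ⟶ a) : X ⟶ (((X ≫ ι) ≫ κ) ≫ ι) ≫ κ := D.cL X ≫ D.cR (X ≫ ι) ▷ κ

theorem cap_naturality {X Y : c ⟶ a} (f : X ⟶ Y) :
    f ▷ ι ▷ κ ▷ ι ▷ κ ≫ D.cap Y = D.cap X ≫ f := by
  simp only [cap, Category.assoc, ← eR_naturality]
  simp only [← comp_whiskerRight_assoc, eL_naturality]

theorem cup_naturality {X Y : c ⟶ a} (f : X ⟶ Y) :
    f ≫ D.cup Y = D.cup X ≫ f ▷ ι ▷ κ ▷ ι ▷ κ := by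
  simp only [cup, Category.assoc, cL_naturality_assoc]
  simp only [← comp_whiskerRight, cR_naturality]

theorem cup_naturality_assoc {X Y : c ⟶ a} (f : X ⟶ Y) {Z : c ⟶ a}
    (h : (((Y ≫ ι) ≫ κ) ≫ ι) ≫ κ ⟶ Z) :
    f ≫ D.cup Y ≫ h = D.cup X ≫ f ▷ ι ▷ κ ▷ ι ▷ κ ≫ h := by
  rw [← Category.assoc, cup_naturality, Category.assoc]

theorem cup_cap (X : c ⟶ a) : D.cup X ▷ ι ▷ κ ≫ D.cap ((X ≫ ι) ≫ κ) = 𝟙 _ := by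
  simp only [cup, cap, comp_whiskerRight, Category.assoc]
  simp only [← comp_whiskerRight_assoc, eL_naturality]
  simp only [comp_whiskerRight, Category.assoc, cR_eR']
  simp [← comp_whiskerRight, cL_eL]

theorem cup_cap_assoc (X : c ⟶ a) {Z : c ⟶ a} (h : (X ≫ ι) ≫ κ ⟶ Z) :
    D.cup X ▷ ι ▷ κ ≫ D.cap ((X ≫ ι) ≫ κ) ≫ h = h := by
  rw [← Category.assoc, cup_cap, Category.id_comp]

theorem cup_cap' (X : c ⟶ a) : D.cup ((X ≫ ι) ≫ κ) ≫ D.cap X ▷ ι ▷ κ = 𝟙 _ := by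
  simp only [cup, cap, comp_whiskerRight, Category.assoc]
  simp only [← comp_whiskerRight_assoc, ← cR_naturality]
  simp only [comp_whiskerRight, Category.assoc, cL_eL'_assoc]
  simp [← comp_whiskerRight, cR_eR]

theorem cup_cap'_assoc (X : c ⟶ a) {Z : c ⟶ a} (h : (X ≫ ι) ≫ κ ⟶ Z) :
    D.cup ((X ≫ ι) ≫ κ) ≫ D.cap X ▷ ι ▷ κ ≫ h = h := by
  rw [← Category.assoc, cup_cap', Category.id_comp]

theorem actA_SA' (x : ι ≫ κ ⟶ ι ≫ κ) (X : c ⟶ a) :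
    actA (D.SA x) X = (D.cup X ≫ actA x ((X ≫ ι) ≫ κ)) ▷ ι ▷ κ ≫ D.cap ((X ≫ ι) ≫ κ) := by
  simp [actA_SA, cup, cap]

theorem actA_SAinv' (x : ι ≫ κ ⟶ ι ≫ κ) (X : c ⟶ a) :
    actA (D.SAinv x) X = D.cup ((X ≫ ι) ≫ κ) ≫ (actA x ((X ≫ ι) ≫ κ) ≫ D.cap X) ▷ ι ▷ κ := by
  simp [actA_SAinv, cup, cap]

theorem actA_SA_cap (x : ι ≫ κ ⟶ ι ≫ κ) (X : c ⟶ a) :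
    actA (D.SA x) ((X ≫ ι) ≫ κ) ≫ D.cap X = actA x X ▷ ι ▷ κ ≫ D.cap X := by
  rw [actA_SA', Category.assoc, ← cap_naturality]
  rw [← comp_whiskerRight_assoc, ← comp_whiskerRight, Category.assoc, ← actA_naturality,
    cup_cap'_assoc]

theorem eq_SA_of_cap {x y : ι ≫ κ ⟶ ι ≫ κ}
    (h : ∀ X : a ⟶ a, actA y ((X ≫ ι) ≫ κ) ≫ D.cap X = actA x X ▷ ι ▷ κ ≫ D.cap X) :
    y = D.SA x := by
  refine actA_injective fun X => ?_
  rw [actA_SA', comp_whiskerRight, comp_whiskerRight, Category.assoc, ← h, actA_naturality_assoc,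
    cup_cap, Category.comp_id]

theorem SA_SAinv (x : ι ≫ κ ⟶ ι ≫ κ) : D.SA (D.SAinv x) = x := by
  refine (D.eq_SA_of_cap fun X => ?_).symm
  rw [actA_SAinv', comp_whiskerRight, comp_whiskerRight, Category.assoc, cap_naturality,
    cup_cap_assoc]

theorem SAinv_SA (x : ι ≫ κ ⟶ ι ≫ κ) : D.SAinv (D.SA x) = x := by
  refine actA_injective fun X => ?_
  rw [actA_SAinv', actA_SA_cap, comp_whiskerRight, comp_whiskerRight, ← cup_naturality_assoc,
    cup_cap', Category.comp_id]

theorem SA_injective : Function.Injective D.SA :=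
  Function.LeftInverse.injective D.SAinv_SA

theorem SA_comp (x y : ι ≫ κ ⟶ ι ≫ κ) : D.SA (x ≫ y) = D.SA y ≫ D.SA x := by
  refine (D.eq_SA_of_cap fun X => ?_).symm
  rw [actA_comp, actA_comp, Category.assoc, actA_SA_cap, ← actA_naturality_assoc, actA_SA_cap]
  simp

theorem actA_SA_eL (x : ι ≫ κ ⟶ ι ≫ κ) (X : c ⟶ a) :
    actA (D.SA x) ((X ≫ ι) ≫ κ) ≫ D.eL (X ≫ ι) ▷ κ =
      (D.cR (X ≫ ι) ▷ κ ≫ actA x ((X ≫ ι) ≫ κ)) ▷ ι ▷ κ ≫ D.cap ((X ≫ ι) ≫ κ) := by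
  rw [comp_whiskerRight, comp_whiskerRight, Category.assoc, ← actA_SA_cap, actA_naturality_assoc]
  congr 1
  rw [cap, ← comp_whiskerRight_assoc, eL_naturality, comp_whiskerRight_assoc, cR_eR',
    Category.comp_id]

theorem actA_SA_eL_assoc (x : ι ≫ κ ⟶ ι ≫ κ) (X : c ⟶ a) {Z : c ⟶ a}
    (h : (X ≫ ι) ≫ κ ⟶ Z) :
    actA (D.SA x) ((X ≫ ι) ≫ κ) ≫ D.eL (X ≫ ι) ▷ κ ≫ h =
      (D.cR (X ≫ ι) ▷ κ ≫ actA x ((X ≫ ι) ≫ κ)) ▷ ι ▷ κ ≫ D.cap ((X ≫ ι) ≫ κ) ≫ h := by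
  rw [← Category.assoc, actA_SA_eL, Category.assoc]

theorem eL_eL (X : c ⟶ b) : D.eL ((X ≫ κ) ≫ ι) ≫ D.eL X = D.eL X ▷ κ ▷ ι ≫ D.eL X :=
  (D.eL_naturality _).symm

theorem cR_whiskerRight_eR {Y : c ⟶ b} {Z W : c ⟶ a} (h : Y ⟶ Z ≫ ι) (f : Z ⟶ W) :
    D.cR Y ≫ (h ▷ κ ≫ D.eR Z ≫ f) ▷ ι = h ≫ f ▷ ι := by
  rw [comp_whiskerRight, comp_whiskerRight, ← cR_naturality_assoc, cR_eR_assoc]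

theorem cR_whiskerRight_eR_assoc {Y V : c ⟶ b} {Z W : c ⟶ a} (h : Y ⟶ Z ≫ ι) (f : Z ⟶ W)
    (k : W ≫ ι ⟶ V) :
    D.cR Y ≫ (h ▷ κ ≫ D.eR Z ≫ f) ▷ ι ≫ k = h ≫ f ▷ ι ≫ k := by
  rw [← Category.assoc, cR_whiskerRight_eR, Category.assoc]

theorem whiskerRight_cR_eR {Y : c ⟶ b} {Z : c ⟶ a} (f : (Y ≫ κ) ⟶ Z) :
    (D.cR Y ≫ f ▷ ι) ▷ κ ≫ D.eR Z = f := by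
  rw [comp_whiskerRight, Category.assoc, eR_naturality, cR_eR'_assoc]

theorem whiskerRight_cL_eL {Z : c ⟶ a} {Y : c ⟶ b} (f : Z ≫ ι ⟶ Y) :
    (D.cL Z ≫ f ▷ κ) ▷ ι ≫ D.eL Y = f := by
  rw [comp_whiskerRight, Category.assoc, eL_naturality, cL_eL_assoc]

theorem eL_cap (X : c ⟶ a) :
    D.eL (((X ≫ ι) ≫ κ) ≫ ι) ▷ κ ≫ D.cap X = D.eL (X ≫ ι) ▷ κ ▷ ι ▷ κ ≫ D.cap X := by
  rw [cap, ← comp_whiskerRight_assoc, ← comp_whiskerRight_assoc, eL_eL]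

theorem actA_conv_SA (w z : ι ≫ κ ⟶ ι ≫ κ) (X : c ⟶ a) :
    actA (D.conv w (D.SA z)) X =
      (D.cR (X ≫ ι) ≫ (actA w X ≫ D.cR (X ≫ ι) ▷ κ ≫ actA z ((X ≫ ι) ≫ κ)) ▷ ι ≫
        D.eL (((X ≫ ι) ≫ κ) ≫ ι)) ▷ κ ≫ D.eR ((X ≫ ι) ≫ κ) := by
  simp [actA_conv, actA_SA_eL, cap]

theorem phiL_conv (w x z : ι ≫ κ ⟶ ι ≫ κ) :
    D.phiL (w ≫ D.conv x z) = D.phiL (D.conv w (D.SA z) ≫ x) := by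
  refine whiskerLeft_one_injective ?_
  rw [whiskerLeft_phiL, whiskerLeft_phiL, actA_comp, actA_comp, actA_conv_SA,
    Category.assoc, cR_whiskerRight_eR_assoc, actA_conv, actA_naturality_assoc]
  simp only [comp_whiskerRight, Category.assoc, eL_eL, ← eL_naturality_assoc]

theorem SA_conv (x y : ι ≫ κ ⟶ ι ≫ κ) : D.SA (D.conv x y) = D.conv (D.SA y) (D.SA x) := by
  refine (D.eq_SA_of_cap fun X => ?_).symm
  rw [actA_conv, Category.assoc, Category.assoc, Category.assoc, eL_cap,
    ← actA_naturality_assoc, actA_SA_cap]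
  simp only [← comp_whiskerRight_assoc, ← comp_whiskerRight]
  rw [actA_SA_eL_assoc, cap, Category.assoc, ← comp_whiskerRight_assoc, cR_whiskerRight_eR]
  rw [actA_conv, actA_naturality_assoc]
  simp only [comp_whiskerRight, Category.assoc, cap]
  simp only [← comp_whiskerRight_assoc, eL_eL, ← eL_naturality_assoc]

theorem conv_assoc (x y z : ι ≫ κ ⟶ ι ≫ κ) :
    D.conv (D.conv x y) z = D.conv x (D.conv y z) := by
  refine actA_injective fun X => ?_
  simp only [actA_conv, comp_whiskerRight, Category.assoc]
  rw [actA_naturality_assoc z]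
  simp only [← comp_whiskerRight_assoc, ← comp_whiskerRight, eL_eL,
    cR_naturality_assoc]

theorem whiskerRight_eR (l : ι ⟶ ι) (X : c ⟶ a) :
    (X ◁ l) ▷ κ ≫ D.eR X = (X ≫ ι) ◁ D.nu l ≫ D.eR X := by
  rw [whiskerLeft_nu, Category.assoc, Category.assoc, ← eR_naturality, ← comp_whiskerRight_assoc,
    ← comp_whiskerRight_assoc, Category.assoc, whisker_exchange, cR_eR_assoc]

theorem whiskerLeft_mu_eL (l : ι ⟶ ι) (X : c ⟶ b) :
    (X ◁ D.mu l) ▷ ι ≫ D.eL X = (X ≫ κ) ◁ l ≫ D.eL X := by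
  rw [whiskerLeft_mu, ← comp_whiskerRight, whiskerRight_cL_eL]

theorem SA_whiskerRight (l : ι ⟶ ι) : D.SA (l ▷ κ) = ι ◁ D.nu l := by
  refine (D.eq_SA_of_cap fun X => ?_).symm
  rw [actA_whiskerRight, actA_whiskerLeft, cap, whisker_exchange_assoc, ← whiskerRight_eR,
    ← comp_whiskerRight_assoc, ← comp_whiskerRight_assoc, eL_naturality]

theorem SA_whiskerLeft_mu (l : ι ⟶ ι) : D.SA (ι ◁ D.mu l) = l ▷ κ := by
  refine (D.eq_SA_of_cap fun X => ?_).symm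
  rw [actA_whiskerRight, actA_whiskerLeft, cap, ← comp_whiskerRight_assoc,
    ← comp_whiskerRight_assoc, whiskerLeft_mu_eL]

/-- The inverse of `nu`. -/
def nuInv (r : κ ⟶ κ) : ι ⟶ ι :=
  (ρ_ ι).inv ≫ ι ◁ D.coevR ≫ (α_ ι κ ι).inv ≫ (ι ◁ r) ▷ ι ≫ D.evR ▷ ι ≫ (λ_ ι).hom

/-- The inverse of `mu`. -/
def muInv (r : κ ⟶ κ) : ι ⟶ ι :=
  (λ_ ι).inv ≫ D.coevL ▷ ι ≫ (ι ◁ r) ▷ ι ≫ (α_ ι κ ι).hom ≫ ι ◁ D.evL ≫ (ρ_ ι).hom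

theorem whiskerLeft_nuInv (r : κ ⟶ κ) (X : c ⟶ a) :
    X ◁ D.nuInv r = D.cR (X ≫ ι) ≫ ((X ≫ ι) ◁ r ≫ D.eR X) ▷ ι := by
  simp only [cR, eR, nuInv]
  bicategory

theorem whiskerLeft_muInv (r : κ ⟶ κ) (X : c ⟶ a) :
    X ◁ D.muInv r = (D.cL X ≫ (X ≫ ι) ◁ r) ▷ ι ≫ D.eL (X ≫ ι) := by
  simp only [cL, eL, muInv]
  bicategory

theorem nu_nuInv (r : κ ⟶ κ) : D.nu (D.nuInv r) = r := by
  refine whiskerLeft_one_injective ?_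
  rw [whiskerLeft_nu, whiskerLeft_nuInv, whiskerRight_cR_eR, ← whisker_exchange_assoc, cR_eR',
    Category.comp_id]

theorem nuInv_nu (l : ι ⟶ ι) : D.nuInv (D.nu l) = l := by
  refine whiskerLeft_one_injective ?_
  rw [whiskerLeft_nuInv, ← whiskerRight_eR, comp_whiskerRight, ← cR_naturality_assoc, cR_eR,
    Category.comp_id]

theorem mu_muInv (r : κ ⟶ κ) : D.mu (D.muInv r) = r := by
  refine whiskerLeft_one_injective ?_
  rw [whiskerLeft_mu, whiskerLeft_muInv, ← comp_whiskerRight, Category.assoc, eL_eL,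
    ← comp_whiskerRight_assoc, comp_whiskerRight, ← cL_naturality_assoc, cL_eL',
    Category.comp_id, Category.assoc, whisker_exchange, cL_eL'_assoc]

theorem conv_whiskerLeft (r : κ ⟶ κ) (x y : ι ≫ κ ⟶ ι ≫ κ) :
    D.conv x (ι ◁ r ≫ y) = ι ◁ r ≫ D.conv x y := by
  refine actA_injective fun X => ?_
  simp only [actA_conv, actA_comp, actA_whiskerLeft, Category.assoc, whisker_exchange_assoc]

theorem conv_whiskerRight (l : ι ⟶ ι) (x y : ι ≫ κ ⟶ ι ≫ κ) :
    D.conv x (y ≫ l ▷ κ) = D.conv (x ≫ ι ◁ D.mu l) y := by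
  refine actA_injective fun X => ?_
  simp only [actA_conv, actA_comp, actA_whiskerLeft, Category.assoc, actA_whiskerRight,
    comp_whiskerRight]
  rw [actA_naturality_assoc y ((X ≫ ι) ◁ D.mu l),
    ← comp_whiskerRight (((X ≫ ι) ◁ D.mu l) ▷ ι), whiskerLeft_mu_eL, comp_whiskerRight]

theorem whiskerLeft_piL (z : ι ≫ κ ⟶ ι ≫ κ) (X : c ⟶ a) :
    X ◁ D.piL z = (D.cL X ≫ actA z X) ▷ ι ≫ D.eL (X ≫ ι) := by
  rw [piL, whiskerLeft_phiL, actA_comp, actA_iA]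
  simp [cR_eR_assoc]

theorem whiskerLeft_piR (z : ι ≫ κ ⟶ ι ≫ κ) (X : c ⟶ b) :
    X ◁ D.piR z = D.cR X ▷ κ ≫ actA z (X ≫ κ) ≫ D.eR (X ≫ κ) := by
  have (Y : c ⟶ a) : Y ◁ D.piL (D.SAinv z) = D.cR (Y ≫ ι) ≫ (actA z Y ≫ D.eR Y) ▷ ι := by
    rw [whiskerLeft_piL, actA_SAinv', cup, Category.assoc, cL_naturality_assoc,
      ← comp_whiskerRight, ← comp_whiskerRight, whiskerRight_cL_eL, cR_naturality_assoc,
      ← comp_whiskerRight, actA_naturality_assoc, cap, ← comp_whiskerRight_assoc, cL_eL]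
    simp
  rw [piR, ← piL, whiskerLeft_nu, this, whiskerRight_cR_eR]

theorem SA_whiskerLeft_piR (z : ι ≫ κ ⟶ ι ≫ κ) : D.SA (ι ◁ D.piR z) = D.piL (D.SA z) ▷ κ := by
  refine (D.eq_SA_of_cap fun X => ?_).symm
  rw [actA_whiskerRight, actA_whiskerLeft, whiskerLeft_piL, whiskerLeft_piR, comp_whiskerRight,
    Category.assoc, eL_cap]
  simp only [← comp_whiskerRight_assoc, ← comp_whiskerRight, Category.assoc]
  rw [actA_SA_eL, ← cL_naturality_assoc, cap, cL_eL'_assoc]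
  simp

section Additive

variable [∀ x y : C, Preadditive (x ⟶ y)]

/-- The whiskerings of the bicategory are additive. -/
structure AdditiveWhiskering (C : Type u) [Bicategory.{w, v} C]
    [∀ x y : C, Preadditive (x ⟶ y)] : Prop where
  left : ∀ {x y z : C} (f : x ⟶ y) {g h : y ⟶ z} (η θ : g ⟶ h), f ◁ (η + θ) = f ◁ η + f ◁ θ
  right : ∀ {x y z : C} {f g : x ⟶ y} (η θ : f ⟶ g) (h : y ⟶ z),
    (η + θ) ▷ h = η ▷ h + θ ▷ h

theorem AdditiveWhiskering.left_sum (H : AdditiveWhiskering C) {x y z : C} (f : x ⟶ y)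
    {g h : y ⟶ z} {J : Type*} (s : Finset J) (η : J → (g ⟶ h)) :
    f ◁ ∑ j ∈ s, η j = ∑ j ∈ s, f ◁ η j :=
  map_sum (AddMonoidHom.mk' (fun θ : g ⟶ h => f ◁ θ) (H.left f)) η s

theorem AdditiveWhiskering.right_sum (H : AdditiveWhiskering C) {x y z : C} {f g : x ⟶ y}
    (h : y ⟶ z) {J : Type*} (s : Finset J) (η : J → (f ⟶ g)) :
    (∑ j ∈ s, η j) ▷ h = ∑ j ∈ s, η j ▷ h :=
  map_sum (AddMonoidHom.mk' (fun θ : f ⟶ g => θ ▷ h) (fun η θ => H.right η θ h)) η s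

theorem actA_sum (H : AdditiveWhiskering C) {J : Type*} (s : Finset J)
    (f : J → (ι ≫ κ ⟶ ι ≫ κ)) (X : c ⟶ a) : actA (∑ j ∈ s, f j) X = ∑ j ∈ s, actA (f j) X := by
  simp [actA, H.left_sum, Preadditive.comp_sum, Preadditive.sum_comp]

theorem SA_sum (H : AdditiveWhiskering C) {J : Type*} (s : Finset J)
    (f : J → (ι ≫ κ ⟶ ι ≫ κ)) : D.SA (∑ j ∈ s, f j) = ∑ j ∈ s, D.SA (f j) := by
  refine actA_injective fun X => ?_
  simp only [actA_sum H, actA_SA', H.right_sum, Preadditive.comp_sum, Preadditive.sum_comp]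

theorem conv_sum (H : AdditiveWhiskering C) {J : Type*} (s : Finset J) (x : ι ≫ κ ⟶ ι ≫ κ)
    (f : J → (ι ≫ κ ⟶ ι ≫ κ)) : D.conv x (∑ j ∈ s, f j) = ∑ j ∈ s, D.conv x (f j) := by
  refine actA_injective fun X => ?_
  simp only [actA_sum H, actA_conv, Preadditive.comp_sum, Preadditive.sum_comp]

theorem sum_conv (H : AdditiveWhiskering C) {J : Type*} (s : Finset J) (x : ι ≫ κ ⟶ ι ≫ κ)
    (f : J → (ι ≫ κ ⟶ ι ≫ κ)) : D.conv (∑ j ∈ s, f j) x = ∑ j ∈ s, D.conv (f j) x := by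
  refine actA_injective fun X => ?_
  simp only [actA_sum H, actA_conv, H.right_sum, Preadditive.comp_sum, Preadditive.sum_comp]

variable {D} {n : ℕ} {y x : ℕ → (ι ≫ κ ⟶ ι ≫ κ)}

theorem sum_actA_d2comp (H : AdditiveWhiskering C)
    (hqb : ∑ i ∈ Finset.range n, D.d2comp (x i) (y i) = 𝟙 ((ι ≫ κ) ≫ ι)) (X : c ⟶ a) :
    ∑ i ∈ Finset.range n, actA (x i) X ▷ ι ≫ D.eL (X ≫ ι) ≫ D.cR (X ≫ ι) ≫ actA (y i) X ▷ ι =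
      𝟙 (((X ≫ ι) ≫ κ) ≫ ι) := by
  have (u v : ι ≫ κ ⟶ ι ≫ κ) :
      actA u X ▷ ι ≫ D.eL (X ≫ ι) ≫ D.cR (X ≫ ι) ≫ actA v X ▷ ι =
        (α_ X ι κ).hom ▷ ι ≫ (α_ X (ι ≫ κ) ι).hom ≫ X ◁ D.d2comp u v ≫
          (α_ X (ι ≫ κ) ι).inv ≫ (α_ X ι κ).inv ▷ ι := by
    simp only [actA, eL, cR, d2comp]
    bicategory
  simp only [this, ← Preadditive.comp_sum, ← Preadditive.sum_comp, ← H.left_sum, hqb]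
  simp

theorem sum_actA_eR (H : AdditiveWhiskering C)
    (hqb : ∑ i ∈ Finset.range n, D.d2comp (x i) (y i) = 𝟙 ((ι ≫ κ) ≫ ι)) (X : c ⟶ a) :
    ∑ i ∈ Finset.range n, (actA (x i) X ▷ ι ≫ D.eL (X ≫ ι)) ▷ κ ≫ actA (y i) X =
      D.eR ((X ≫ ι) ≫ κ) := by
  have := congrArg (· ▷ κ ≫ D.eR ((X ≫ ι) ≫ κ)) (sum_actA_d2comp H hqb X)
  rw [H.right_sum, Preadditive.sum_comp] at this
  simpa [eR_naturality, cR_eR'_assoc] using this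

theorem sum_actA_cL (H : AdditiveWhiskering C)
    (hqb : ∑ i ∈ Finset.range n, D.d2comp (x i) (y i) = 𝟙 ((ι ≫ κ) ≫ ι)) (X : c ⟶ a) :
    ∑ i ∈ Finset.range n, actA (x i) X ≫ (D.cR (X ≫ ι) ≫ actA (y i) X ▷ ι) ▷ κ =
      D.cL ((X ≫ ι) ≫ κ) := by
  have := congrArg (D.cL ((X ≫ ι) ≫ κ) ≫ · ▷ κ) (sum_actA_d2comp H hqb X)
  rw [H.right_sum, Preadditive.comp_sum] at this
  simpa [← cL_naturality_assoc, cL_eL'_assoc] using this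

theorem sum_phiL_comp (H : AdditiveWhiskering C)
    (hqb : ∑ i ∈ Finset.range n, D.d2comp (x i) (y i) = 𝟙 ((ι ≫ κ) ≫ ι))
    (z : ι ≫ κ ⟶ ι ≫ κ) :
    ∑ i ∈ Finset.range n, D.phiL (z ≫ x i) ▷ κ ≫ y i = z := by
  refine actA_injective fun X => ?_
  have (i : ℕ) : actA (D.phiL (z ≫ x i) ▷ κ ≫ y i) X = (D.cR (X ≫ ι) ≫ actA z X ▷ ι) ▷ κ ≫
      (actA (x i) X ▷ ι ≫ D.eL (X ≫ ι)) ▷ κ ≫ actA (y i) X := by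
    simp [actA_comp, actA_whiskerRight, whiskerLeft_phiL]
  rw [actA_sum H]
  simp only [this, ← Preadditive.comp_sum]
  rw [sum_actA_eR H hqb, whiskerRight_cR_eR]

theorem sum_comp_phiL (H : AdditiveWhiskering C)
    (hqb : ∑ i ∈ Finset.range n, D.d2comp (x i) (y i) = 𝟙 ((ι ≫ κ) ≫ ι))
    (z : ι ≫ κ ⟶ ι ≫ κ) :
    ∑ i ∈ Finset.range n, x i ≫ D.phiL (y i ≫ z) ▷ κ = z := by
  refine actA_injective fun X => ?_
  have (i : ℕ) : actA (x i ≫ D.phiL (y i ≫ z) ▷ κ) X =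
      (actA (x i) X ≫ (D.cR (X ≫ ι) ≫ actA (y i) X ▷ ι) ▷ κ) ≫ actA z X ▷ ι ▷ κ ≫
        D.eL (X ≫ ι) ▷ κ := by
    simp [actA_comp, actA_whiskerRight, whiskerLeft_phiL]
  rw [actA_sum H]
  simp only [this, ← Preadditive.sum_comp]
  rw [sum_actA_cL H hqb, ← cL_naturality_assoc, cL_eL', Category.comp_id]

theorem sum_conv_comp (H : AdditiveWhiskering C)
    (hqb : ∑ i ∈ Finset.range n, D.d2comp (x i) (y i) = 𝟙 ((ι ≫ κ) ≫ ι))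
    (z : ι ≫ κ ⟶ ι ≫ κ) :
    ∑ i ∈ Finset.range n, D.conv (x i) z ≫ y i = ι ◁ D.piR z := by
  refine actA_injective fun X => ?_
  have (i : ℕ) : actA (D.conv (x i) z ≫ y i) X = (D.cR (X ≫ ι) ▷ κ ≫ actA z ((X ≫ ι) ≫ κ)) ≫
      (actA (x i) X ▷ ι ≫ D.eL (X ≫ ι)) ▷ κ ≫ actA (y i) X := by
    simp [actA_comp, actA_conv, actA_naturality_assoc]
  rw [actA_sum H]
  simp only [this, ← Preadditive.comp_sum]
  rw [sum_actA_eR H hqb, actA_whiskerLeft, whiskerLeft_piR, Category.assoc]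

theorem sum_nu_comp_conv (H : AdditiveWhiskering C)
    (hqb : ∑ i ∈ Finset.range n, D.d2comp (x i) (y i) = 𝟙 ((ι ≫ κ) ≫ ι))
    (p z : ι ≫ κ ⟶ ι ≫ κ) :
    ∑ i ∈ Finset.range n, ι ◁ D.nu (D.phiL (y i ≫ z)) ≫ D.conv p (D.SA (x i)) =
      D.conv p (D.SA z) := by
  conv_rhs => rw [← sum_comp_phiL H hqb z]
  simp only [SA_sum D H, conv_sum D H, SA_comp, SA_whiskerRight, conv_whiskerLeft]

theorem sum_SAinv_comp_mu (H : AdditiveWhiskering C)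
    (hqb : ∑ i ∈ Finset.range n, D.d2comp (x i) (y i) = 𝟙 ((ι ≫ κ) ≫ ι))
    (p z : ι ≫ κ ⟶ ι ≫ κ) :
    ∑ i ∈ Finset.range n, D.SAinv (y i) ≫ ι ◁ D.mu (D.phiL (p ≫ D.conv (x i) z)) =
      D.conv z (D.SAinv p) := by
  refine D.SA_injective ?_
  rw [SA_conv, SA_SAinv, ← sum_phiL_comp H hqb (D.conv p (D.SA z)), SA_sum D H]
  simp only [SA_comp, SA_SAinv, SA_whiskerLeft_mu, phiL_conv]

/-- The mixed coassociativity `(γ_R ⊗ id) ∘ γ_L = (id ⊗ γ_L) ∘ γ_R`, evaluated against a balanced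
triadditive map. -/
theorem sum_balanced_eq (H : AdditiveWhiskering C)
    (hqb : ∑ i ∈ Finset.range n, D.d2comp (x i) (y i) = 𝟙 ((ι ≫ κ) ≫ ι))
    {M : Type*} [AddCommGroup M]
    (g : (ι ≫ κ ⟶ ι ≫ κ) →+ (ι ≫ κ ⟶ ι ≫ κ) →+ (ι ≫ κ ⟶ ι ≫ κ) →+ M)
    (hR : ∀ (l : ι ⟶ ι) u v t, g (ι ◁ D.nu l ≫ u) v t = g u (l ▷ κ ≫ v) t)
    (hL : ∀ (l : ι ⟶ ι) u v t, g u (v ≫ ι ◁ D.mu l) t = g u v (t ≫ l ▷ κ))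
    (z : ι ≫ κ ⟶ ι ≫ κ) :
    ∑ i ∈ Finset.range n, ∑ j ∈ Finset.range n,
        g (D.conv (D.SAinv (y i)) (D.SA (x j))) (y j) (D.conv (x i) z) =
      ∑ i ∈ Finset.range n, ∑ j ∈ Finset.range n,
        g (D.conv z (D.SA (x i))) (D.SAinv (y j)) (D.conv (x j) (y i)) := by
  have expandR (u v t) : g u v t =
      ∑ i ∈ Finset.range n, g (ι ◁ D.nu (D.phiL (v ≫ x i)) ≫ u) (y i) t := by
    conv_lhs => rw [← sum_phiL_comp H hqb v]
    simp [hR]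
  have expandL (u v t) : g u v t =
      ∑ j ∈ Finset.range n, g u (v ≫ ι ◁ D.mu (D.phiL (y j ≫ t))) (x j) := by
    conv_lhs => rw [← sum_comp_phiL H hqb t]
    simp [hL]
  have collapseR (p w : ι ≫ κ ⟶ ι ≫ κ) (t) :
      ∑ m ∈ Finset.range n, g (D.conv p (D.SA (x m))) (y m ≫ w) t =
        ∑ i ∈ Finset.range n, g (D.conv p (D.SA (w ≫ x i))) (y i) t := by
    rw [Finset.sum_congr rfl fun m _ => expandR _ (y m ≫ w) t, Finset.sum_comm]
    refine Finset.sum_congr rfl fun i _ => ?_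
    simp only [Category.assoc, ← sum_nu_comp_conv H hqb p (w ≫ x i), map_sum,
      AddMonoidHom.finsetSum_apply]
  have lhs (i) : ∑ j ∈ Finset.range n,
      g (D.conv (D.SAinv (y i)) (D.SA (x j))) (y j) (D.conv (x i) z) =
      ∑ j ∈ Finset.range n, ∑ m ∈ Finset.range n,
        g (D.conv (D.SAinv (y i) ≫ ι ◁ D.mu (D.phiL (y j ≫ D.conv (x i) z))) (D.SA (x m)))
          (y m) (x j) := by
    rw [Finset.sum_congr rfl fun j _ => expandL _ (y j) (D.conv (x i) z), Finset.sum_comm]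
    refine Finset.sum_congr rfl fun j _ => ?_
    rw [collapseR]
    simp only [SA_comp, SA_whiskerLeft_mu, conv_whiskerRight]
  have rhs (i) : ∑ j ∈ Finset.range n,
      g (D.conv z (D.SA (x i))) (D.SAinv (y j)) (D.conv (x j) (y i)) =
      ∑ j ∈ Finset.range n, g (D.conv z (D.SA (x i)))
        (D.conv (y i) (D.SAinv (y j))) (x j) := by
    rw [Finset.sum_congr rfl fun j _ => expandL _ (D.SAinv (y j)) (D.conv (x j) (y i)),
      Finset.sum_comm]
    refine Finset.sum_congr rfl fun j _ => ?_
    simp only [← sum_SAinv_comp_mu H hqb, map_sum, AddMonoidHom.finsetSum_apply]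
  rw [Finset.sum_congr rfl fun i _ => lhs i, Finset.sum_congr rfl fun i _ => rhs i,
    Finset.sum_comm, Finset.sum_comm (s := Finset.range n)
      (f := fun i j => g (D.conv z (D.SA (x i))) (D.conv (y i) (D.SAinv (y j))) (x j))]
  refine Finset.sum_congr rfl fun j _ => ?_
  have phi_rotate (i m) : D.phiL (D.conv (y i) (D.SAinv (y j)) ≫ x m) =
      D.phiL (y i ≫ D.conv (x m) (D.SAinv (D.SAinv (y j)))) := by
    rw [phiL_conv, SA_SAinv]
  rw [Finset.sum_comm,
    Finset.sum_congr rfl fun i _ => expandR _ (D.conv (y i) (D.SAinv (y j))) (x j),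
    Finset.sum_comm (s := Finset.range n) (f := fun i m => g (ι ◁ D.nu
      (D.phiL (D.conv (y i) (D.SAinv (y j)) ≫ x m)) ≫ D.conv z (D.SA (x i))) (y m) (x j))]
  refine Finset.sum_congr rfl fun m _ => ?_
  simp only [phi_rotate, ← AddMonoidHom.finsetSum_apply, ← map_sum, sum_nu_comp_conv H hqb,
    ← sum_conv D H, sum_SAinv_comp_mu H hqb, SA_conv, SA_SAinv, conv_assoc]

end Additive

theorem tR_eq (r : κ ⟶ κ) : D.tR r = D.nuInv r ▷ κ := by
  rw [tR]
  congr 1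
  have : Nonempty (ι ⟶ ι) := ⟨𝟙 ι⟩
  exact Function.LeftInverse.injective D.nuInv_nu
    ((Function.invFun_eq ⟨_, D.nu_nuInv r⟩).trans (D.nu_nuInv r).symm)

end FrobeniusDuality

open FrobeniusDuality in
/-- For a D2 Frobenius 1-morphism `ι`, the left bialgebroid over `L`, the
right bialgebroid over `R` (with `γ_R(a) = ∑ᵢ (a ∗ S_A(xᵢ)) ⊗ yᵢ`, counit `π_R`, source
`s_R(r) = ι×r`, target `t_R(r) = ν⁻¹(r)×κ`) and the antipode `S_A = Ḟ⁻¹∘F` form a Hopf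
algebroid: the subring identifications hold, mixed coassociativity holds (expressed by
evaluation against balanced triadditive maps), `S_A` is a bijective twisted bimodule map,
and `S_A(a₍₁₎)∘a₍₂₎ = s_R(π_R(a))`, `a⁽¹⁾∘S_A(a⁽²⁾) = s_L(π_L(a))`.
(The ring product of the paper is `u ∘ v = v ≫ u`.) -/
theorem hopf_algebroid_structure
    {C : Type u} [Bicategory.{w, v} C] [∀ (x y : C), Preadditive (x ⟶ y)]
    (wl : ∀ {x y z : C} (f : x ⟶ y) {g h : y ⟶ z} (η θ : g ⟶ h),
      f ◁ (η + θ) = f ◁ η + f ◁ θ)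
    (wr : ∀ {x y z : C} {f g : x ⟶ y} (η θ : f ⟶ g) (h : y ⟶ z),
      (η + θ) ▷ h = η ▷ h + θ ▷ h)
    {a b : C} {ι : a ⟶ b} {κ : b ⟶ a} (D : FrobeniusDuality ι κ)
    (n : ℕ) (y x : ℕ → (ι ≫ κ ⟶ ι ≫ κ))
    (hqb : ∑ i ∈ Finset.range n, D.d2comp (x i) (y i) = 𝟙 ((ι ≫ κ) ≫ ι)) :
    -- (i) subring identifications
    Set.range D.sL = Set.range D.tR ∧ Set.range D.tL = Set.range D.sR ∧
    -- (ii) mixed coassociativity `(γ_L ⊗ id)∘γ_R = (id ⊗ γ_R)∘γ_L`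
    (∀ (M : Type w) (_ : AddCommGroup M)
      (g : (ι ≫ κ ⟶ ι ≫ κ) → (ι ≫ κ ⟶ ι ≫ κ) → (ι ≫ κ ⟶ ι ≫ κ) → M),
      (∀ u u' v w', g (u + u') v w' = g u v w' + g u' v w') →
      (∀ u v v' w', g u (v + v') w' = g u v w' + g u v' w') →
      (∀ u v w' w'', g u v (w' + w'') = g u v w' + g u v w'') →
      (∀ (l : ι ⟶ ι) u v w', g (u ≫ D.tL l) v w' = g u (v ≫ D.sL l) w') →
      (∀ (r : κ ⟶ κ) u v w', g u (D.sR r ≫ v) w' = g u v (D.tR r ≫ w')) →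
      ∀ z, ∑ i ∈ Finset.range n, ∑ j ∈ Finset.range n,
          g (D.SAinv (y j)) (D.conv (x j) (D.conv z (D.SA (x i)))) (y i) =
        ∑ i ∈ Finset.range n, ∑ j ∈ Finset.range n,
          g (D.SAinv (y i)) (D.conv (D.conv (x i) z) (D.SA (x j))) (y j)) ∧
    -- (ii') mixed coassociativity `(γ_R ⊗ id)∘γ_L = (id ⊗ γ_L)∘γ_R`
    (∀ (M : Type w) (_ : AddCommGroup M)
      (g : (ι ≫ κ ⟶ ι ≫ κ) → (ι ≫ κ ⟶ ι ≫ κ) → (ι ≫ κ ⟶ ι ≫ κ) → M),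
      (∀ u u' v w', g (u + u') v w' = g u v w' + g u' v w') →
      (∀ u v v' w', g u (v + v') w' = g u v w' + g u v' w') →
      (∀ u v w' w'', g u v (w' + w'') = g u v w' + g u v w'') →
      (∀ (r : κ ⟶ κ) u v w', g (D.sR r ≫ u) v w' = g u (D.tR r ≫ v) w') →
      (∀ (l : ι ⟶ ι) u v w', g u (v ≫ D.tL l) w' = g u v (w' ≫ D.sL l)) →
      ∀ z, ∑ i ∈ Finset.range n, ∑ j ∈ Finset.range n,
          g (D.conv (D.SAinv (y i)) (D.SA (x j))) (y j) (D.conv (x i) z) =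
        ∑ i ∈ Finset.range n, ∑ j ∈ Finset.range n,
          g (D.conv z (D.SA (x i))) (D.SAinv (y j)) (D.conv (x j) (y i))) ∧
    -- (iii) `S_A` is a bijective twisted bimodule map
    (∀ z, D.SAinv (D.SA z) = z) ∧ (∀ z, D.SA (D.SAinv z) = z) ∧
    (∀ (l l' : ι ⟶ ι) z,
      D.SA (D.tL l' ≫ z ≫ D.tL l) = D.sL l ≫ D.SA z ≫ D.sL l') ∧
    (∀ (r r' : κ ⟶ κ) z,
      D.SA (D.tR r ≫ z ≫ D.tR r') = D.sR r' ≫ D.SA z ≫ D.sR r) ∧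
    -- (iv) the antipode axioms
    (∀ z, ∑ i ∈ Finset.range n, (D.conv (x i) z ≫ D.SA (D.SAinv (y i))) =
      D.sR (D.piR z)) ∧
    (∀ z, ∑ i ∈ Finset.range n, (D.SA (y i) ≫ D.conv z (D.SA (x i))) =
      D.sL (D.piL z)) := by
  have H : AdditiveWhiskering C := ⟨wl, wr⟩
  refine ⟨?_, ?_, ?_, ?_, D.SAinv_SA, D.SA_SAinv, ?_, ?_, ?_, ?_⟩
  · refine Set.Subset.antisymm ?_ ?_
    · rintro _ ⟨l, rfl⟩
      exact ⟨D.nu l, by rw [tR_eq, nuInv_nu, sL]⟩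
    · rintro _ ⟨r, rfl⟩
      exact ⟨D.nuInv r, by rw [tR_eq, sL]⟩
  · refine Set.Subset.antisymm ?_ ?_
    · rintro _ ⟨l, rfl⟩
      exact ⟨D.mu l, rfl⟩
    · rintro _ ⟨r, rfl⟩
      exact ⟨D.muInv r, by rw [tL, mu_muInv, sR]⟩
  · intro M _ g _ _ _ _ _ z
    rw [Finset.sum_comm]
    simp only [conv_assoc]
  · intro M _ g h₁ h₂ h₃ hR hL z
    refine sum_balanced_eq H hqb
      (AddMonoidHom.mk' (fun u => AddMonoidHom.mk' (fun v => AddMonoidHom.mk' (g u v) (h₃ u v))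
        fun v v' => AddMonoidHom.ext fun t => h₂ u v v' t)
        fun u u' => AddMonoidHom.ext fun v => AddMonoidHom.ext fun t => h₁ u u' v t) ?_ ?_ z
    · intro l u v t
      simpa [sR, tR_eq, nuInv_nu] using hR (D.nu l) u v t
    · exact hL
  · intro l l' z
    simp [SA_comp, tL, sL, SA_whiskerLeft_mu]
  · intro r r' z
    simp [SA_comp, tR_eq, sR, SA_whiskerRight, nu_nuInv]
  · intro z
    simpa only [SA_SAinv, sR] using sum_conv_comp H hqb z
  · intro z
    rw [sL, ← D.SA_SAinv z, ← SA_whiskerLeft_piR, ← sum_conv_comp H hqb, SA_sum D H]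
    simp only [SA_comp, SA_conv]
end
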